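/- arXiv:2012.05666 — 3 statements merged into one kernel-verified Lean document; each statement's English description precedes it below -/
import Mathlib

section
/- For every α ∈ (0,1) and x ≥ 0, one has E_{α,1,1−1/α}(−x) ≥ (1 + √(Γ(1−α)/Γ(1+α)) x)^{−2}. -/
/-- The Kilbas-Saigo function `E_{α,m,l}(x)` for real argument. -/
noncomputable def kilbasSaigo (α m l : ℝ) (x : ℝ) : ℝ :=
  ∑' n : ℕ, (∏ k ∈ Finset.range n,
    Real.Gamma (1 + α * (k * m + l)) / Real.Gamma (1 + α * (k * m + l + 1))) * x ^ n

open Real Set Filter Topology MeasureTheory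

/-- Laplace transform on the half line. -/
noncomputable def Lap (f : ℝ → ℝ) (t : ℝ) : ℝ := ∫ r in Ioi (0:ℝ), exp (-(r*t)) * f r

lemma lap_deriv {f : ℝ → ℝ} (h : ∀ t, 0 < t → IntegrableOn (fun r => exp (-(r*t)) * f r) (Ioi 0))
    {t : ℝ} (ht : 0 < t) :
    IntegrableOn (fun r => exp (-(r*t)) * (r * f r)) (Ioi 0) ∧
    HasDerivAt (Lap f) (-(Lap (fun r => r * f r) t)) t := by
  have key := hasDerivAt_integral_of_dominated_loc_of_deriv_le (μ := volume.restrict (Ioi (0:ℝ)))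
    (F := fun t r => exp (-(r*t)) * f r) (F' := fun t r => -(exp (-(r*t)) * (r * f r)))
    (x₀ := t) (s := Ioi (t/2)) (bound := fun r => (4/t) * ‖exp (-(r*(t/4))) * f r‖)
    (Ioi_mem_nhds (by linarith)) ?_ (h t ht) ?_ ?_ ?_ ?_
  · refine ⟨?_, ?_⟩
    · have := key.1.neg
      simpa [IntegrableOn] using this
    · have := key.2
      rw [integral_neg] at this
      exact this
  · filter_upwards [lt_mem_nhds ht] with x hx
    exact (h x hx).aestronglyMeasurable
  · have h1 := (h t ht).aestronglyMeasurable
    have h2 : AEStronglyMeasurable (fun r : ℝ => -r) (volume.restrict (Ioi (0:ℝ))) := by fun_prop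
    refine (h2.mul h1).congr (ae_of_all _ fun r => ?_)
    simp only [Pi.mul_apply]; ring
  · filter_upwards [ae_restrict_mem measurableSet_Ioi] with r hr x hx
    simp only [mem_Ioi] at hr hx
    rw [norm_neg, norm_mul, norm_mul, norm_mul, Real.norm_of_nonneg (exp_pos _).le,
      Real.norm_of_nonneg (exp_pos _).le, Real.norm_of_nonneg hr.le]
    have e1 : exp (-(r*x)) ≤ exp (-(r*(t/4))) * exp (-(r*(t/4))) := by
      rw [← Real.exp_add]; apply Real.exp_le_exp.2; nlinarith
    have e2 : r * (t/4) * exp (-(r*(t/4))) ≤ 1 := by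
      have := Real.add_one_le_exp (r*(t/4))
      rw [Real.exp_neg, ← div_eq_mul_inv, div_le_one (exp_pos _)]; linarith
    have e3 : r * exp (-(r*x)) ≤ 4/t * exp (-(r*(t/4))) := by
      calc r * exp (-(r*x)) ≤ r * (exp (-(r*(t/4))) * exp (-(r*(t/4)))) := by gcongr
        _ = (4/t) * ((r * (t/4) * exp (-(r*(t/4)))) * exp (-(r*(t/4)))) := by field_simp
        _ ≤ (4/t) * (1 * exp (-(r*(t/4)))) := by gcongr
        _ = _ := by ring
    calc exp (-(r*x)) * (r * ‖f r‖) = (r * exp (-(r*x))) * ‖f r‖ := by ring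
      _ ≤ (4/t * exp (-(r*(t/4)))) * ‖f r‖ := by gcongr
      _ = _ := by ring
  · exact ((h (t/4) (by linarith)).norm).const_mul _
  · filter_upwards with r x hx
    have : HasDerivAt (fun x => exp (-(r*x)) * f r) (exp (-(r*x)) * (-(r*1)) * f r) x :=
      ((((hasDerivAt_id x).const_mul r).neg).exp).mul_const _
    exact this.congr_deriv (by ring)

lemma exp_int {t : ℝ} (ht : 0 < t) : IntegrableOn (fun r => exp (-(r*t))) (Ioi 0) := by
  have := integrableOn_exp_mul_Ioi (a := -t) (by linarith) 0
  refine this.congr_fun (fun r _ => ?_) measurableSet_Ioi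
  simp only; congr 1; ring

lemma lap_int {f : ℝ → ℝ} {C : ℝ} (hc : ContinuousOn f (Ioi 0)) (hC : ∀ r, 0 < r → |f r| ≤ C)
    {t : ℝ} (ht : 0 < t) : IntegrableOn (fun r => exp (-(r*t)) * f r) (Ioi 0) := by
  refine Integrable.mono' (g := fun r => C * exp (-(r*t))) ((exp_int ht).const_mul C) ?_ ?_
  · refine ContinuousOn.aestronglyMeasurable ?_ measurableSet_Ioi
    exact (by fun_prop : Continuous fun r : ℝ => exp (-(r*t))).continuousOn.mul hc
  · filter_upwards [ae_restrict_mem measurableSet_Ioi] with r hr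
    rw [norm_mul, Real.norm_of_nonneg (exp_pos _).le, mul_comm]
    exact mul_le_mul_of_nonneg_right (hC r hr) (exp_pos _).le

lemma lap_ibp {f f1 : ℝ → ℝ} {C : ℝ} (hd : ∀ r, 0 < r → HasDerivAt f (f1 r / r) r)
    (hc1 : ContinuousOn f1 (Ioi 0)) (hC : ∀ r, 0 < r → |f r| ≤ C) (hC1 : ∀ r, 0 < r → |f1 r| ≤ C)
    {t : ℝ} (ht : 0 < t) :
    t * Lap (fun r => r * f r) t = Lap f t + Lap f1 t := by
  have hc : ContinuousOn f (Ioi 0) := fun r hr => (hd r hr).continuousAt.continuousWithinAt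
  have i0 : ∀ t : ℝ, 0 < t → IntegrableOn (fun r => exp (-(r*t)) * f r) (Ioi 0) := fun t ht => lap_int hc hC (t := t) ht
  have i1 := lap_int hc1 hC1 ht
  have i2 := (lap_deriv i0 ht).1
  have lim0 : Tendsto (fun r => r * exp (-(r*t))) atTop (𝓝 0) := by
    have := (tendsto_rpow_mul_exp_neg_mul_atTop_nhds_zero 1 t ht)
    refine this.congr fun r => ?_
    rw [rpow_one]; congr 2; ring
  have bd : ∀ r, 0 < r → ‖exp (-(r*t)) * (r * f r)‖ ≤ C * (r * exp (-(r*t))) := by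
    intro r hr
    rw [norm_mul, norm_mul, Real.norm_of_nonneg (exp_pos _).le, Real.norm_of_nonneg hr.le]
    have := mul_le_mul_of_nonneg_right (hC r hr) (mul_pos hr (exp_pos (-(r*t)))).le
    rw [Real.norm_eq_abs]; linarith
  have key := integral_Ioi_of_hasDerivAt_of_tendsto (a := (0:ℝ)) (m := 0)
    (f := fun r => exp (-(r*t)) * (r * f r))
    (f' := fun r => (exp (-(r*t)) * f r + exp (-(r*t)) * f1 r) - t * (exp (-(r*t)) * (r * f r)))
    ?_ ?_ ?_ ?_
  · have i3 : IntegrableOn (fun r => exp (-(r*t)) * f r + exp (-(r*t)) * f1 r) (Ioi 0) :=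
      (i0 t ht).add i1
    rw [integral_sub i3 (i2.const_mul t), integral_const_mul, integral_add (i0 t ht) i1] at key
    simp only [zero_mul, mul_zero, sub_zero] at key
    unfold Lap; linarith
  · rw [ContinuousWithinAt]
    simp only [zero_mul, mul_zero]
    rw [← Ioi_insert, nhdsWithin_insert]
    refine Tendsto.sup ?_ ?_
    · rw [tendsto_pure_left]
      intro s hs; simpa using mem_of_mem_nhds hs
    refine squeeze_zero_norm' (a := fun r => C * (r * exp (-(r*t)))) ?_ ?_
    · filter_upwards [self_mem_nhdsWithin] with r hr using bd r hr
    · have : Continuous fun r : ℝ => C * (r * exp (-(r*t))) := by fun_prop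
      have := this.tendsto 0
      simp only [zero_mul, mul_zero] at this
      exact this.mono_left nhdsWithin_le_nhds
  · intro r hr
    have hr' : (0:ℝ) < r := hr
    have e : HasDerivAt (fun r => exp (-(r*t))) (exp (-(r*t)) * (-(1*t))) r :=
      (((hasDerivAt_id r).mul_const t).neg).exp
    have := e.fun_mul ((hasDerivAt_id' r).fun_mul (hd r hr'))
    refine this.congr_deriv ?_
    field_simp
    ring
  · exact ((i0 t ht).add i1).sub (i2.const_mul t)
  · refine squeeze_zero_norm' (a := fun r => C * (r * exp (-(r*t)))) ?_ ?_
    · filter_upwards [eventually_gt_atTop 0] with r hr using bd r hr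
    · simpa using lim0.const_mul C

lemma lap_scale {f f1 : ℝ → ℝ} {C : ℝ} (hd : ∀ r, 0 < r → HasDerivAt f (f1 r / r) r)
    (hc1 : ContinuousOn f1 (Ioi 0)) (hC : ∀ r, 0 < r → |f r| ≤ C) (hC1 : ∀ r, 0 < r → |f1 r| ≤ C)
    (β : ℝ) {t : ℝ} (ht : 0 < t) :
    HasDerivAt (fun t => t ^ β * Lap f t) (t ^ (β - 1) * ((β - 1) * Lap f t - Lap f1 t)) t := by
  have hc : ContinuousOn f (Ioi 0) := fun r hr => (hd r hr).continuousAt.continuousWithinAt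
  have i0 : ∀ t : ℝ, 0 < t → IntegrableOn (fun r => exp (-(r*t)) * f r) (Ioi 0) := fun t ht => lap_int hc hC (t := t) ht
  have := (Real.hasDerivAt_rpow_const (p := β) (Or.inl ht.ne')).fun_mul (lap_deriv i0 ht).2
  refine this.congr_deriv ?_
  have h := lap_ibp hd hc1 hC hC1 ht
  have : t ^ β = t ^ (β - 1) * t := by
    rw [← rpow_add_one ht.ne']; congr 1; ring
  rw [this]
  linear_combination (-t ^ (β-1)) * h

lemma antitoneOn_Ioi_of_deriv {f f' : ℝ → ℝ} {a : ℝ} (hd : ∀ t, a < t → HasDerivAt f (f' t) t)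
    (hn : ∀ t, a < t → f' t ≤ 0) : AntitoneOn f (Ioi a) := by
  refine antitoneOn_of_deriv_nonpos (convex_Ioi a)
    (fun t ht => (hd t ht).continuousAt.continuousWithinAt) ?_ ?_
  · rw [interior_Ioi]; exact fun t ht => (hd t ht).differentiableAt.differentiableWithinAt
  · rw [interior_Ioi]; intro t ht; rw [(hd t ht).deriv]; exact hn t ht

lemma lap_sign {G : ℝ → ℝ} (h : ∀ t : ℝ, 0 < t → IntegrableOn (fun r => exp (-(r*t)) * G r) (Ioi 0))
    {r1 r2 : ℝ} (hG : ∀ r, 0 < r → (r - r1) * (r - r2) * G r ≤ 0)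
    {t1 t2 : ℝ} (ht1 : 0 < t1) (h12 : t1 < t2) (hA1 : Lap G t1 < 0) (hA2 : 0 < Lap G t2) :
    ∀ t, 0 < t → t ≤ t1 → Lap G t < 0 := by
  have h1 : ∀ t : ℝ, 0 < t → IntegrableOn (fun r => exp (-(r*t)) * (r * G r)) (Ioi 0) :=
    fun t ht => (lap_deriv h ht).1
  have h2 : ∀ t : ℝ, 0 < t → IntegrableOn (fun r => exp (-(r*t)) * (r * (r * G r))) (Ioi 0) :=
    fun t ht => (lap_deriv h1 ht).1
  have d0 := fun t (ht : 0 < t) => (lap_deriv h ht).2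
  have d1 := fun t (ht : 0 < t) => (lap_deriv h1 ht).2
  have ex : ∀ c t : ℝ, HasDerivAt (fun t => exp (c * t)) (exp (c*t) * (c * 1)) t := fun c t =>
    ((hasDerivAt_id' t).const_mul c).exp
  set B : ℝ → ℝ := fun t => r1 * Lap G t - Lap (fun r => r * G r) t with hB
  have dg : ∀ t, 0 < t → HasDerivAt (fun t => exp (r1 * t) * Lap G t) (exp (r1 * t) * B t) t := by
    intro t ht
    refine ((ex r1 t).fun_mul (d0 t ht)).congr_deriv ?_
    simp only [hB]; ring
  have neg : ∀ t, 0 < t → r1 * r2 * Lap G t - (r1 + r2) * Lap (fun r => r * G r) t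
      + Lap (fun r => r * (r * G r)) t ≤ 0 := by
    intro t ht
    have : r1 * r2 * Lap G t - (r1 + r2) * Lap (fun r => r * G r) t
      + Lap (fun r => r * (r * G r)) t = ∫ r in Ioi (0:ℝ), exp (-(r*t)) * ((r - r1) * (r-r2) * G r) := by
      unfold Lap
      have i3 : IntegrableOn (fun r => r1 * r2 * (exp (-(r*t)) * G r)
        - (r1 + r2) * (exp (-(r*t)) * (r * G r))) (Ioi 0) :=
        ((h t ht).const_mul (r1*r2)).sub ((h1 t ht).const_mul (r1 + r2))
      rw [← integral_const_mul, ← integral_const_mul, ← integral_sub ((h t ht).const_mul _)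
        ((h1 t ht).const_mul _), ← integral_add i3 (h2 t ht)]
      congr 1; ext r; ring
    rw [this]
    refine setIntegral_nonpos measurableSet_Ioi fun r hr => ?_
    exact mul_nonpos_of_nonneg_of_nonpos (exp_pos _).le (hG r hr)
  have dh : ∀ t, 0 < t → HasDerivAt (fun t => exp (r2 * t) * B t)
      (exp (r2 * t) * (r1 * r2 * Lap G t - (r1 + r2) * Lap (fun r => r * G r) t
      + Lap (fun r => r * (r * G r)) t)) t := by
    intro t ht
    refine ((ex r2 t).fun_mul (((d0 t ht).const_mul r1).fun_sub (d1 t ht))).congr_deriv ?_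
    ring
  have anti := antitoneOn_Ioi_of_deriv dh
    (fun t ht => mul_nonpos_of_nonneg_of_nonpos (exp_pos _).le (neg t ht))
  obtain ⟨ξ, hξ, hξe⟩ := exists_hasDerivAt_eq_slope (fun t => exp (r1 * t) * Lap G t)
    (fun t => exp (r1 * t) * B t) h12
    (fun t ht => (dg t (ht1.trans_le ht.1)).continuousAt.continuousWithinAt)
    (fun t ht => dg t (ht1.trans ht.1))
  have hBξ : 0 < B ξ := by
    have : 0 < exp (r1 * ξ) * B ξ := by
      rw [hξe]
      apply div_pos _ (by linarith)
      have := mul_pos (exp_pos (r1*t2)) hA2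
      have := mul_pos (exp_pos (r1*t1)) (neg_pos.2 hA1)
      linarith
    exact pos_of_mul_pos_right this (exp_pos _).le
  have hBp : ∀ t, 0 < t → t ≤ ξ → 0 ≤ B t := by
    intro t ht htξ
    have := anti (mem_Ioi.2 ht) (mem_Ioi.2 (ht1.trans hξ.1)) htξ
    have h3 := mul_pos (exp_pos (r2*ξ)) hBξ
    have : 0 < exp (r2 * t) * B t := lt_of_lt_of_le h3 this
    exact (pos_of_mul_pos_right this (exp_pos _).le).le
  intro t ht htt
  have mono : MonotoneOn (fun t => exp (r1 * t) * Lap G t) (Icc t t1) := by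
    refine monotoneOn_of_deriv_nonneg (convex_Icc _ _)
      (fun s hs => (dg s (ht.trans_le hs.1)).continuousAt.continuousWithinAt) ?_ ?_
    · rw [interior_Icc]
      exact fun s hs => (dg s (ht.trans hs.1)).differentiableAt.differentiableWithinAt
    · rw [interior_Icc]; intro s hs; rw [(dg s (ht.trans hs.1)).deriv]
      exact mul_nonneg (exp_pos _).le (hBp s (ht.trans hs.1) (hs.2.le.trans hξ.1.le))
  have := mono ⟨le_refl _, htt⟩ ⟨htt, le_refl _⟩ htt
  simp only at this
  have h4 := mul_pos (exp_pos (r1*t1)) (neg_pos.2 hA1)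
  by_contra hc
  push Not at hc
  have := mul_nonneg (exp_pos (r1*t)).le hc
  linarith

noncomputable def kD (b z : ℝ) : ℝ := z^2 + 2*b*z + 1
noncomputable def k0 (b z : ℝ) : ℝ := z / kD b z
noncomputable def k1 (b z : ℝ) : ℝ := z * (1 - z^2) / kD b z ^ 2
noncomputable def kG (b z : ℝ) : ℝ := 2*z^2*(3*b*z^2+(2*b^2+4)*z+3*b) / kD b z ^ 3
noncomputable def k2 (b z : ℝ) : ℝ := k0 b z - kG b z

lemma kD_ge {b z : ℝ} (hz : 0 ≤ z) : (1 - |b|) * (1 + z^2) ≤ kD b z := by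
  unfold kD
  have h1 := neg_abs_le b
  have h2 := abs_nonneg b
  nlinarith [mul_nonneg h2 (sq_nonneg (z-1)), mul_nonneg hz (by linarith : 0 ≤ b + |b|)]

lemma kD_pos {b z : ℝ} (hb : |b| < 1) (hz : 0 ≤ z) : 0 < kD b z :=
  lt_of_lt_of_le (by have : 0 < 1 - |b| := by linarith
                     positivity) (kD_ge hz)

lemma kD_deriv (b z : ℝ) : HasDerivAt (kD b) (2*z+2*b) z := by
  unfold kD
  have := (((hasDerivAt_pow 2 z)).fun_add ((hasDerivAt_id' z).const_mul (2*b))).add_const 1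
  refine this.congr_deriv ?_
  norm_num

lemma k0_deriv {b z : ℝ} (hb : |b| < 1) (hz : 0 < z) : HasDerivAt (k0 b) (k1 b z / z) z := by
  have hD := kD_pos hb hz.le
  have := (hasDerivAt_id' z).fun_div (kD_deriv b z) hD.ne'
  refine this.congr_deriv ?_
  unfold k1
  field_simp
  unfold kD; ring

lemma k1_deriv {b z : ℝ} (hb : |b| < 1) (hz : 0 < z) : HasDerivAt (k1 b) (k2 b z / z) z := by
  have hD := kD_pos hb hz.le
  have := ((hasDerivAt_id' z).fun_mul ((hasDerivAt_pow 2 z).const_sub 1)).fun_div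
    ((kD_deriv b z).fun_pow 2) (pow_ne_zero 2 hD.ne')
  refine this.congr_deriv ?_
  unfold k2 k0 kG
  field_simp
  unfold kD; push_cast; ring

lemma k_aux {b z : ℝ} (hb : |b| < 1) (hz : 0 < z) :
    (1 + z^2) / kD b z ≤ (1 - |b|)⁻¹ := by
  have hD := kD_pos hb hz.le
  have h : 0 < 1 - |b| := by linarith
  rw [div_le_iff₀ hD, inv_mul_eq_div, le_div_iff₀ h]
  linarith [kD_ge (b := b) hz.le]

lemma k0_nonneg {b z : ℝ} (hb : |b| < 1) (hz : 0 < z) : 0 ≤ k0 b z :=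
  div_nonneg hz.le (kD_pos hb hz.le).le

lemma k0_le_z {b z : ℝ} (hb : |b| < 1) (hz : 0 < z) : |k0 b z| ≤ (1 - |b|)⁻¹ * z := by
  have hD := kD_pos hb hz.le
  rw [abs_of_nonneg (k0_nonneg hb hz)]
  refine le_trans ?_ (mul_le_mul_of_nonneg_right (k_aux hb hz) hz.le)
  unfold k0
  rw [div_mul_eq_mul_div]
  gcongr
  nlinarith [sq_nonneg z]

lemma k0_le {b z : ℝ} (hb : |b| < 1) (hz : 0 < z) : |k0 b z| ≤ (1 - |b|)⁻¹ := by
  have hD := kD_pos hb hz.le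
  rw [abs_of_nonneg (k0_nonneg hb hz)]
  refine le_trans ?_ (k_aux hb hz)
  unfold k0
  gcongr
  nlinarith [sq_nonneg (z-1)]

lemma k1_le {b z : ℝ} (hb : |b| < 1) (hz : 0 < z) : |k1 b z| ≤ |k0 b z| * (1 - |b|)⁻¹ := by
  have hD := kD_pos hb hz.le
  have : k1 b z = k0 b z * ((1 - z^2) / kD b z) := by
    unfold k1 k0; field_simp
  rw [this, abs_mul]
  gcongr
  refine le_trans ?_ (k_aux hb hz)
  rw [abs_div, abs_of_pos hD]
  gcongr
  rw [abs_le]; constructor <;> nlinarith [sq_nonneg z]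

lemma kG_le {b z : ℝ} (hb : |b| < 1) (hz : 0 < z) :
    |kG b z| ≤ |k0 b z| * ((1 - |b|)⁻¹ * (18 * (1 - |b|)⁻¹)) := by
  have hD := kD_pos hb hz.le
  have : kG b z = k0 b z * ((z / kD b z) * (2 * (3*b*z^2+(2*b^2+4)*z+3*b) / kD b z)) := by
    unfold kG k0; field_simp
  rw [this, abs_mul, abs_mul]
  have e1 := k0_le hb hz
  unfold k0 at e1 ⊢
  gcongr
  rw [abs_div, abs_of_pos hD]
  have e2 := k_aux hb hz
  calc _ ≤ 18 * (1 + z^2) / kD b z := by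
        gcongr
        rw [abs_le] at *
        have hb' := abs_lt.1 hb
        have : b^2 ≤ 1 := by nlinarith
        constructor
        · nlinarith [mul_nonneg (sq_nonneg z) (by linarith : 0 ≤ 1 + b), mul_nonneg hz.le (sq_nonneg b)]
        · nlinarith [mul_nonneg (sq_nonneg z) (by linarith : 0 ≤ 1 - b), mul_nonneg hz.le (by linarith : 0 ≤ 1 - b^2), sq_nonneg (z-1)]
    _ = 18 * ((1+z^2) / kD b z) := by ring
    _ ≤ _ := by gcongr

/-- common bound for all kernels -/
lemma k_bdd {b : ℝ} (hb : |b| < 1) : ∃ C : ℝ, 0 ≤ C ∧ ∀ z, 0 < z → |k0 b z| ≤ C ∧ |k1 b z| ≤ C ∧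
    |k2 b z| ≤ C ∧ |k0 b z| ≤ C * z ∧ |k1 b z| ≤ C * z ∧ |kG b z| ≤ C := by
  set e := (1 - |b|)⁻¹ with he
  have h : 0 < e := by rw [he]; apply inv_pos.2; linarith
  refine ⟨e + e*e + e*(e*(18*e)), by positivity, fun z hz => ?_⟩
  have a0 := k0_le hb hz
  have a1 := k1_le hb hz
  have a2 := kG_le hb hz
  have a3 := k0_le_z hb hz
  rw [← he] at a0 a1 a2 a3
  have q1 : |k0 b z| * e ≤ e * e := by gcongr
  have q2 : |k0 b z| * (e * (18*e)) ≤ e * (e * (18*e)) := by gcongr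
  have q3 : |k0 b z| * e ≤ e * z * e := by gcongr
  have p1 : 0 < e * e := by positivity
  have p2 : 0 < e * (e * (18*e)) := by positivity
  have p3 := mul_pos p1 hz
  have p4 := mul_pos p2 hz
  have p5 := mul_pos h hz
  refine ⟨by linarith, by linarith, ?_, by nlinarith, by nlinarith, by linarith⟩
  unfold k2
  have := abs_sub (k0 b z) (kG b z)
  linarith

lemma kG_sign {b : ℝ} (hb : |b| < 1) (hb0 : b < 0) : ∃ z1 z2 : ℝ, 0 < z1 ∧ 0 < z2 ∧
    ∀ z, 0 < z → (z - z1) * (z - z2) * kG b z ≤ 0 := by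
  have hb' := abs_lt.1 hb
  set S := sqrt ((2*b^2+4)^2 - 36*b^2) with hS
  have hS2 : S^2 = (2*b^2+4)^2 - 36*b^2 := by
    rw [hS, sq_sqrt]; nlinarith [mul_nonneg (by nlinarith : 0 ≤ 1 - b^2) (by nlinarith : 0 ≤ 4 - b^2)]
  have hS0 : 0 ≤ S := sqrt_nonneg _
  have hSlt : S < 2*b^2+4 := by
    have : 0 < b^2 := by have := mul_pos_of_neg_of_neg hb0 hb0; nlinarith
    apply lt_of_pow_lt_pow_left₀ 2 (by positivity)
    rw [hS2]; linarith
  refine ⟨(2*b^2+4 - S) / (-6*b), (2*b^2+4+S)/(-6*b), div_pos (by linarith) (by linarith),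
    div_pos (by positivity) (by linarith), fun z hz => ?_⟩
  have hD := kD_pos hb hz.le
  have hbn : b ≠ 0 := hb0.ne
  have e : 3*b*z^2+(2*b^2+4)*z+3*b =
      3*b*((z - (2*b^2+4 - S) / (-6*b)) * (z - (2*b^2+4+S)/(-6*b))) := by
    field_simp
    linear_combination (3) * hS2
  unfold kG
  rw [e]
  set w := (z - (2*b^2+4 - S) / (-6*b)) * (z - (2*b^2+4+S)/(-6*b))
  have : w * (2 * z^2 * (3*b*w) / kD b z ^3) = b * (6 * z^2 * w^2 / kD b z ^ 3) := by ring
  rw [this]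
  exact mul_nonpos_of_nonpos_of_nonneg hb0.le (by positivity)

lemma lap_rpow_int {a t : ℝ} (ha : -1 < a) (ht : 0 < t) :
    IntegrableOn (fun r => exp (-(r*t)) * r ^ a) (Ioi 0) := by
  refine (integrableOn_rpow_mul_exp_neg_mul_rpow ha one_pos ht).congr_fun (fun r _ => ?_) measurableSet_Ioi
  simp only [rpow_one]; rw [mul_comm]; congr 2; ring

lemma lap_rpow {a t : ℝ} (ha : -1 < a) (ht : 0 < t) :
    Lap (fun r => r ^ a) t = t ^ (-(a+1)) * Gamma (a + 1) := by
  have := integral_rpow_mul_exp_neg_mul_Ioi (a := a + 1) (r := t) (by linarith) ht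
  rw [one_div, inv_rpow ht.le, ← rpow_neg ht.le] at this
  rw [← this]
  unfold Lap
  congr 1; ext r; rw [mul_comm]; congr 2 <;> ring_nf

section
variable {α b : ℝ}

lemma rp_deriv {k k' : ℝ → ℝ} (hk : ∀ z, 0 < z → HasDerivAt k (k' z / z) z) {r : ℝ} (hr : 0 < r) :
    HasDerivAt (fun r => k (r ^ α)) (α * k' (r ^ α) / r) r := by
  have hz : 0 < r ^ α := rpow_pos_of_pos hr _
  have := (hk _ hz).comp r (Real.hasDerivAt_rpow_const (p := α) (Or.inl hr.ne'))
  refine this.congr_deriv ?_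
  have e : r ^ α = r ^ (α - 1) * r := by
    rw [← rpow_add_one hr.ne']; congr 1; ring
  have : r ^ (α-1) ≠ 0 := (rpow_pos_of_pos hr _).ne'
  rw [e]; field_simp

lemma rp_cont {k k' : ℝ → ℝ} (hk : ∀ z, 0 < z → HasDerivAt k (k' z / z) z) :
    ContinuousOn (fun r => k (r ^ α)) (Ioi 0) := fun _ hr =>
  (rp_deriv hk hr).continuousAt.continuousWithinAt

lemma kG_cont (hb : |b| < 1) : ContinuousOn (fun r => kG b (r ^ α)) (Ioi 0) := by
  intro r hr
  have hz : 0 < r ^ α := rpow_pos_of_pos hr _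
  have h1 : ContinuousAt (kG b) (r^α) := by
    unfold kG
    refine ContinuousAt.div (by fun_prop) ?_ (pow_ne_zero 3 (kD_pos hb hz.le).ne')
    exact (kD_deriv b _).continuousAt.pow 3
  have h2 : ContinuousAt (fun r : ℝ => r ^ α) r := continuousAt_rpow_const _ _ (Or.inl (ne_of_gt hr))
  exact (ContinuousAt.comp (f := fun r : ℝ => r ^ α) h1 h2).continuousWithinAt

noncomputable def L0 (α b : ℝ) : ℝ → ℝ := Lap (fun r => k0 b (r ^ α))
noncomputable def L1 (α b : ℝ) : ℝ → ℝ := Lap (fun r => k1 b (r ^ α))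
noncomputable def LG (α b : ℝ) : ℝ → ℝ := Lap (fun r => kG b (r ^ α))
noncomputable def Qf (α b t : ℝ) : ℝ := t ^ (1 - α) * ((L0 α b t - L1 α b t) / 2)

lemma i0 (hb : |b| < 1) {t : ℝ} (ht : 0 < t) :
    IntegrableOn (fun r => exp (-(r*t)) * k0 b (r ^ α)) (Ioi 0) := by
  obtain ⟨C, _, hC⟩ := k_bdd hb
  exact lap_int (rp_cont fun z hz => k0_deriv hb hz)
    (fun r hr => (hC _ (rpow_pos_of_pos hr _)).1) ht

lemma i1 (hb : |b| < 1) {t : ℝ} (ht : 0 < t) :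
    IntegrableOn (fun r => exp (-(r*t)) * k1 b (r ^ α)) (Ioi 0) := by
  obtain ⟨C, _, hC⟩ := k_bdd hb
  exact lap_int (rp_cont fun z hz => k1_deriv hb hz)
    (fun r hr => (hC _ (rpow_pos_of_pos hr _)).2.1) ht

lemma iG (hb : |b| < 1) {t : ℝ} (ht : 0 < t) :
    IntegrableOn (fun r => exp (-(r*t)) * kG b (r ^ α)) (Ioi 0) := by
  obtain ⟨C, _, hC⟩ := k_bdd hb
  exact lap_int (kG_cont hb) (fun r hr => (hC _ (rpow_pos_of_pos hr _)).2.2.2.2.2) ht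

lemma lap_const_mul (c : ℝ) (f : ℝ → ℝ) (t : ℝ) : Lap (fun r => c * f r) t = c * Lap f t := by
  unfold Lap; rw [← integral_const_mul]; congr 1; ext r; ring

lemma d0 (hα : 0 < α) (hb : |b| < 1) (β : ℝ) {t : ℝ} (ht : 0 < t) :
    HasDerivAt (fun t => t ^ β * L0 α b t)
      (t ^ (β - 1) * ((β - 1) * L0 α b t - α * L1 α b t)) t := by
  obtain ⟨C, hC0, hC⟩ := k_bdd hb
  have := lap_scale (f := fun r => k0 b (r ^ α)) (f1 := fun r => α * k1 b (r ^ α))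
    (C := C + α * C)
    (fun r hr => rp_deriv (fun z hz => k0_deriv hb hz) hr)
    ((rp_cont fun z hz => k1_deriv hb hz).const_smul α)
    (fun r hr => (hC _ (rpow_pos_of_pos hr _)).1.trans (by nlinarith))
    (fun r hr => by
      rw [abs_mul, abs_of_pos hα]
      have := (hC _ (rpow_pos_of_pos hr α)).2.1
      nlinarith) β ht
  rw [lap_const_mul] at this
  exact this

lemma k2_cont (hb : |b| < 1) : ContinuousOn (fun r => k2 b (r ^ α)) (Ioi 0) := 
  (rp_cont fun z hz => k0_deriv hb hz).sub (kG_cont hb)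

lemma d1 (hα : 0 < α) (hb : |b| < 1) (β : ℝ) {t : ℝ} (ht : 0 < t) :
    HasDerivAt (fun t => t ^ β * L1 α b t)
      (t ^ (β - 1) * ((β - 1) * L1 α b t - α * (L0 α b t - LG α b t))) t := by
  obtain ⟨C, hC0, hC⟩ := k_bdd hb
  have := lap_scale (f := fun r => k1 b (r ^ α)) (f1 := fun r => α * k2 b (r ^ α))
    (C := C + α * C)
    (fun r hr => rp_deriv (fun z hz => k1_deriv hb hz) hr)
    ((k2_cont hb).const_smul α)
    (fun r hr => (hC _ (rpow_pos_of_pos hr _)).2.1.trans (by nlinarith))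
    (fun r hr => by
      rw [abs_mul, abs_of_pos hα]
      have := (hC _ (rpow_pos_of_pos hr α)).2.2.1
      nlinarith) β ht
  rw [lap_const_mul] at this
  have e : Lap (fun r => k2 b (r ^ α)) t = L0 α b t - LG α b t := by
    unfold L0 LG Lap
    rw [← integral_sub (i0 hb ht) (iG hb ht)]
    congr 1; ext r; unfold k2; ring
  rw [e] at this
  exact this

lemma dQ (hα : 0 < α) (hb : |b| < 1) {t : ℝ} (ht : 0 < t) :
    HasDerivAt (Qf α b) (-(α/2 * t ^ (-α) * LG α b t)) t := by
  have := ((d0 hα hb (1-α) ht).fun_sub (d1 hα hb (1-α) ht)).div_const 2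
  have h2 : HasDerivAt (Qf α b) _ t := this.congr_of_eventuallyEq
    (Eventually.of_forall fun t => by simp only [Qf]; ring)
  refine h2.congr_deriv ?_
  have : (1 - α - 1) = -α := by ring
  rw [this]; ring

/-- Derivative of the power times the function P. -/
lemma dP (hα : 0 < α) (hb : |b| < 1) {t : ℝ} (ht : 0 < t) :
    HasDerivAt (fun t => t ^ (1 + α) * L0 α b t) (2 * α * t ^ (2*α-1) * Qf α b t) t := by
  refine (d0 hα hb (1+α) ht).congr_deriv ?_
  unfold Qf
  have : t ^ (1 + α - 1) = t ^ (2*α - 1) * t ^ (1-α) := by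
    rw [← rpow_add ht]; congr 1; ring
  rw [this]; ring

lemma LG_pos_near (hα : 0 < α) (hb : |b| < 1) {c0 : ℝ} (hc0 : 0 < c0) {F : ℝ → ℝ}
    (hF : ContDiff ℝ 2 F) (hF1 : deriv F 0 < 0)
    (hP : ∀ t, 0 < t → F (t ^ α) = c0 * (t ^ (1-α) * L0 α b t)) :
    ∃ ε > 0, ∀ t, 0 < t → t < ε → 0 < LG α b t := by
  have hd1 : Differentiable ℝ F := hF.differentiable (by norm_num)
  have hF' : ContDiff ℝ 1 (deriv F) := by
    have : ContDiff ℝ (1+1) F := by convert hF using 1; norm_num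
    exact (contDiff_succ_iff_deriv.1 this).2.2
  have hd2 : Differentiable ℝ (deriv F) := hF'.differentiable (by norm_num)
  have hc2 : Continuous (deriv (deriv F)) := hF'.continuous_deriv (by norm_num)
  have hc1 : Continuous (deriv F) := hF'.continuous
  have hdx : ∀ t : ℝ, 0 < t → HasDerivAt (fun t : ℝ => t ^ α) (α * t ^ (α-1)) t := fun t ht =>
    Real.hasDerivAt_rpow_const (p := α) (Or.inl ht.ne')
  -- Q in terms of F
  have hQ : ∀ t, 0 < t → F (t^α) + t^α * deriv F (t^α) / 2 = c0 * Qf α b t := by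
    intro t ht
    have e1 : HasDerivAt (fun t => F (t^α)) (deriv F (t^α) * (α * t^(α-1))) t :=
      (hd1 _).hasDerivAt.comp t (hdx t ht)
    have e2 : HasDerivAt (fun t => F (t^α)) _ t :=
      ((d0 hα hb (1-α) ht).const_mul c0).congr_of_eventuallyEq
        (by filter_upwards [lt_mem_nhds ht] with s hs using hP s hs)
    have e := e1.unique e2
    rw [hP t ht]
    unfold Qf
    have x1 : t ^ α = t ^ (α-1) * t := by rw [← rpow_add_one ht.ne']; congr 1; ring
    have x2 : t ^ (1-α) = t ^ (1-α-1) * t := by rw [← rpow_add_one ht.ne']; congr 1; ring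
    have : α * (t^α * deriv F (t^α)) = α * (c0 * (t^(1-α) * (-L0 α b t - L1 α b t))) := by
      rw [x2]; nth_rewrite 1 [x1]
      linear_combination t * e
    have := mul_left_cancel₀ hα.ne' this
    linear_combination (1/2) * this
  have hcont : Continuous fun x => 3 * deriv F x + x * deriv (deriv F) x := by fun_prop
  have hev : ∀ᶠ x in 𝓝 (0:ℝ), 3 * deriv F x + x * deriv (deriv F) x < 0 := by
    refine hcont.continuousAt.eventually_lt_const ?_
    simp only [zero_mul]; linarith
  have hx0 : Tendsto (fun t : ℝ => t ^ α) (𝓝 0) (𝓝 0) := by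
    have := (continuousAt_rpow_const 0 α (Or.inr hα.le)).tendsto
    rwa [zero_rpow hα.ne'] at this
  obtain ⟨ε, hε, h⟩ := Metric.eventually_nhds_iff.1 (hx0.eventually hev)
  refine ⟨ε, hε, fun t ht htε => ?_⟩
  have hneg := h (y := t) (by rw [Real.dist_eq, sub_zero, abs_of_pos ht]; exact htε)
  have e1 : HasDerivAt (fun t => F (t^α) + t^α * deriv F (t^α) / 2) _ t :=
    ((hd1 _).hasDerivAt.comp t (hdx t ht)).fun_add
      (((hdx t ht).fun_mul ((hd2 _).hasDerivAt.comp t (hdx t ht))).div_const 2)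
  have e2 : HasDerivAt (fun t => F (t^α) + t^α * deriv F (t^α) / 2) _ t :=
    ((dQ hα hb ht).const_mul c0).congr_of_eventuallyEq
        (by filter_upwards [lt_mem_nhds ht] with s hs using hQ s hs)
  have e := e1.unique e2
  simp only [Function.comp] at e
  have p1 : 0 < α * t ^ (α-1) := mul_pos hα (rpow_pos_of_pos ht _)
  have p2 : 0 < t ^ (-α) := rpow_pos_of_pos ht _
  by_contra hc
  push Not at hc
  have : 0 ≤ c0 * (-(α/2 * t ^ (-α) * LG α b t)) := by
    apply mul_nonneg hc0.le
    have : 0 < α/2 * t^(-α) := by positivity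
    nlinarith
  rw [← e] at this
  have := mul_neg_of_pos_of_neg p1 hneg
  linarith

lemma LG_persist (hα : 0 < α) (hb : |b| < 1) {ε : ℝ} (hε : 0 < ε)
    (hpos : ∀ t, 0 < t → t < ε → 0 < LG α b t) {t1 t2 : ℝ} (ht1 : 0 < t1) (h12 : t1 < t2)
    (h1 : LG α b t1 < 0) : LG α b t2 ≤ 0 := by
  by_contra hc
  push Not at hc
  rcases le_or_gt 0 b with hb0 | hb0
  · have : 0 ≤ LG α b t1 := by
      refine setIntegral_nonneg measurableSet_Ioi fun r hr => ?_
      have hz : 0 < r ^ α := rpow_pos_of_pos hr _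
      refine mul_nonneg (exp_pos _).le ?_
      have := kD_pos hb hz.le
      unfold kG; positivity
    linarith
  · obtain ⟨z1, z2, hz1, hz2, hs⟩ := kG_sign hb hb0
    have key : ∀ z1 : ℝ, 0 < z1 → ∀ r : ℝ, 0 < r → ∃ m, 0 < m ∧ r - z1 ^ (1/α) = m * (r^α - z1) := by
      intro z1 hz1 r hr
      set r1 := z1 ^ (1/α)
      have hr1 : 0 < r1 := rpow_pos_of_pos hz1 _
      have e : z1 = r1 ^ α := by
        rw [← rpow_mul hz1.le, one_div_mul_cancel hα.ne', rpow_one]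
      rcases lt_trichotomy r r1 with h | h | h
      · have : r ^ α < r1 ^ α := rpow_lt_rpow hr.le h hα
        refine ⟨(r - r1) / (r^α - z1), div_pos_of_neg_of_neg (by linarith) (by linarith), ?_⟩
        have : r^α - z1 ≠ 0 := by linarith
        field_simp
      · refine ⟨1, one_pos, ?_⟩
        rw [e, h]; simp
      · have : r1 ^ α < r ^ α := rpow_lt_rpow hr1.le h hα
        refine ⟨(r - r1) / (r^α - z1), div_pos (by linarith) (by linarith), ?_⟩
        have : r^α - z1 ≠ 0 := by linarith
        field_simp
    have := lap_sign (G := fun r => kG b (r^α)) (fun t ht => iG hb ht) (r1 := z1 ^ (1/α))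
      (r2 := z2 ^ (1/α)) (by
        intro r hr
        obtain ⟨m1, hm1, e1⟩ := key z1 hz1 r hr
        obtain ⟨m2, hm2, e2⟩ := key z2 hz2 r hr
        rw [e1, e2]
        have := mul_nonneg (mul_pos hm1 hm2).le (neg_nonneg.2 (hs _ (rpow_pos_of_pos hr α)))
        nlinarith) ht1 h12 h1 hc
    have h3 := this (min (ε/2) t1) (by positivity) (min_le_right _ _)
    have h4 := hpos (min (ε/2) t1) (by positivity) (lt_of_le_of_lt (min_le_left _ _) (by linarith))
    unfold LG at h4
    linarith
end

section
variable {α b : ℝ}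

lemma Q_tendsto (hα : 0 < α) (hb : |b| < 1) : Tendsto (Qf α b) atTop (𝓝 0) := by
  obtain ⟨C, hC0, hC⟩ := k_bdd hb
  have bd : ∀ t, 0 < t → ‖Qf α b t‖ ≤ C * Gamma (α+1) * t ^ (-(2*α)) := by
    intro t ht
    have e : L0 α b t - L1 α b t = ∫ r in Ioi (0:ℝ), exp (-(r*t)) * (k0 b (r^α) - k1 b (r^α)) := by
      unfold L0 L1 Lap
      rw [← integral_sub (i0 hb ht) (i1 hb ht)]
      congr 1; ext r; ring
    have e2 : ‖L0 α b t - L1 α b t‖ ≤ 2 * C * Lap (fun r => r^α) t := by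
      rw [e]
      unfold Lap
      rw [← integral_const_mul]
      refine norm_integral_le_of_norm_le ((lap_rpow_int (by linarith) ht).const_mul _) ?_
      filter_upwards [ae_restrict_mem measurableSet_Ioi] with r hr
      have hz : 0 < r ^ α := rpow_pos_of_pos hr _
      obtain ⟨-, -, -, h0, h1, -⟩ := hC _ hz
      rw [norm_mul, Real.norm_of_nonneg (exp_pos _).le, Real.norm_eq_abs]
      have := (abs_sub (k0 b (r^α)) (k1 b (r^α)))
      calc exp (-(r*t)) * |k0 b (r^α) - k1 b (r^α)| ≤ exp (-(r*t)) * (2 * C * r^α) := by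
            gcongr; linarith
        _ = _ := by ring
    rw [lap_rpow (by linarith) ht] at e2
    unfold Qf
    rw [norm_mul, norm_div, Real.norm_of_nonneg (rpow_pos_of_pos ht _).le]
    calc t^(1-α) * (‖L0 α b t - L1 α b t‖ / ‖(2:ℝ)‖)
        ≤ t^(1-α) * ((2 * C * (t ^ (-(α+1)) * Gamma (α+1))) / ‖(2:ℝ)‖) := by gcongr
      _ = C * Gamma (α+1) * (t^(1-α) * t^(-(α+1))) := by norm_num; ring
      _ = _ := by rw [← rpow_add ht]; congr 2; ring
  refine squeeze_zero_norm' (a := fun t => C * Gamma (α+1) * t ^ (-(2*α))) ?_ ?_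
  · filter_upwards [eventually_gt_atTop 0] with t ht using bd t ht
  · simpa using (tendsto_rpow_neg_atTop (y := 2*α) (by linarith)).const_mul (C * Gamma (α+1))

lemma P_lower (hα : 0 < α) (hb : |b| < 1) {t : ℝ} (ht : 0 < t) :
    Gamma (α+1) - 2*b*(t^(-α) * Gamma (2*α+1)) - t^(-(2*α)) * Gamma (3*α+1) ≤ t^(1+α) * L0 α b t := by
  have j1 := lap_rpow_int (a := α) (by linarith) ht
  have j2 := lap_rpow_int (a := 2*α) (by linarith) ht
  have j3 := lap_rpow_int (a := 3*α) (by linarith) ht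
  have h : Lap (fun r => r^α) t - 2*b*Lap (fun r => r^(2*α)) t - Lap (fun r => r^(3*α)) t ≤ L0 α b t := by
    have i12 : IntegrableOn (fun r => exp (-(r*t)) * r^α - 2*b*(exp (-(r*t)) * r^(2*α))) (Ioi 0) :=
      j1.sub (j2.const_mul (2*b))
    unfold L0 Lap
    rw [← integral_const_mul, ← integral_sub j1 (j2.const_mul _), ← integral_sub i12 j3]
    refine setIntegral_mono_on (i12.sub j3) (i0 hb ht) measurableSet_Ioi fun r hr => ?_
    have hz : 0 < r ^ α := rpow_pos_of_pos hr _
    have hr' : (0:ℝ) < r := hr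
    have e2 : r^(2*α) = (r^α)^2 := by rw [mul_comm, rpow_mul hr'.le]; norm_cast
    have e3 : r^(3*α) = (r^α)^3 := by rw [mul_comm, rpow_mul hr'.le]; norm_cast
    rw [e2, e3]
    set z := r^α
    have hD := kD_pos hb hz.le
    have : z - 2*b*z^2 - z^3 ≤ k0 b z := by
      unfold k0
      rw [le_div_iff₀ hD]
      have : z - (z - 2*b*z^2 - z^3) * kD b z = z * (z^2+2*b*z)^2 := by unfold kD; ring
      have : 0 ≤ z * (z^2+2*b*z)^2 := by positivity
      linarith
    calc _ = exp (-(r*t)) * (z - 2*b*z^2 - z^3) := by ring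
      _ ≤ _ := by gcongr
  rw [lap_rpow (by linarith) ht, lap_rpow (by linarith) ht, lap_rpow (by linarith) ht] at h
  have h2 := mul_le_mul_of_nonneg_left h (rpow_pos_of_pos ht (1+α)).le
  refine le_trans (le_of_eq ?_) h2
  have a1 : t^(1+α) * t^(-(α+1)) = 1 := by rw [← rpow_add ht]; ring_nf; simp
  have a2 : t^(1+α) * t^(-(2*α+1)) = t^(-α) := by rw [← rpow_add ht]; congr 1; ring
  have a3 : t^(1+α) * t^(-(3*α+1)) = t^(-(2*α)) := by rw [← rpow_add ht]; congr 1; ring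
  rw [← a2, ← a3]
  linear_combination (-Gamma (α+1)) * a1

lemma Q_key (hα : 0 < α) (hb : |b| < 1) {ε : ℝ} (hε : 0 < ε)
    (hpos : ∀ t, 0 < t → t < ε → 0 < LG α b t) {s t : ℝ} (hs : 0 < s) (hst : s < t)
    (h : Qf α b s < Qf α b t) : Qf α b t ≤ 0 := by
  obtain ⟨ξ, hξ, he⟩ := exists_hasDerivAt_eq_slope (Qf α b) _ hst
    (fun u hu => (dQ hα hb (hs.trans_le hu.1)).continuousAt.continuousWithinAt)
    (fun u hu => dQ hα hb (hs.trans hu.1))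
  have hξ0 : 0 < ξ := hs.trans hξ.1
  have hp : 0 < (Qf α b t - Qf α b s) / (t - s) := div_pos (by linarith) (by linarith)
  rw [← he] at hp
  have hneg : LG α b ξ < 0 := by
    have : 0 < α/2 * ξ^(-α) := by have := rpow_pos_of_pos hξ0 (-α); positivity
    by_contra hc
    push Not at hc
    have := mul_nonneg this.le hc
    linarith
  have anti : AntitoneOn (fun u => - Qf α b u) (Ioi ξ) := by
    refine antitoneOn_Ioi_of_deriv (fun u hu => (dQ hα hb (hξ0.trans hu)).fun_neg) fun u hu => ?_
    have h1 := LG_persist hα hb hε hpos hξ0 hu hneg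
    have : 0 < α/2 * u^(-α) := by have := rpow_pos_of_pos (hξ0.trans hu) (-α); positivity
    nlinarith
  refine ge_of_tendsto (Q_tendsto hα hb) ?_
  filter_upwards [eventually_ge_atTop t] with u hu
  have := anti (mem_Ioi.2 hξ.2) (mem_Ioi.2 (hξ.2.trans_le hu)) hu
  simp only at this
  linarith

/-- the dichotomy -/
lemma dichotomy (hα : 0 < α) (hb : |b| < 1) {ε : ℝ} (hε : 0 < ε)
    (hpos : ∀ t, 0 < t → t < ε → 0 < LG α b t) {t0 : ℝ} (ht0 : 0 < t0) :
    Gamma (α+1) ≤ t0^(1+α) * L0 α b t0 ∨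
    ∃ q : ℝ, ∀ s, 0 < s → s^(1-α) * L0 α b s ≤ t0^(1-α) * L0 α b t0 + q * ((t0/s)^(2*α) - 1) := by
  rcases le_or_gt (Qf α b t0) 0 with hQ | hQ
  · left
    have hQ' : ∀ t, t0 < t → Qf α b t ≤ 0 := by
      intro t ht
      by_contra hc
      push Not at hc
      exact absurd (Q_key hα hb hε hpos ht0 ht (by linarith)) (by linarith)
    have anti : AntitoneOn (fun t => t ^ (1 + α) * L0 α b t) (Ici t0) := by
      refine antitoneOn_of_deriv_nonpos (convex_Ici t0)
        (fun t ht => (dP hα hb (ht0.trans_le ht)).continuousAt.continuousWithinAt) ?_ ?_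
      · rw [interior_Ici]
        exact fun t ht => (dP hα hb (ht0.trans ht)).differentiableAt.differentiableWithinAt
      · rw [interior_Ici]; intro t ht; rw [(dP hα hb (ht0.trans ht)).deriv]
        have := rpow_pos_of_pos (ht0.trans ht) (2*α-1)
        exact mul_nonpos_of_nonneg_of_nonpos (by positivity) (hQ' t ht)
    have lim : Tendsto (fun t : ℝ => Gamma (α+1) - 2*b*(t^(-α) * Gamma (2*α+1))
        - t^(-(2*α)) * Gamma (3*α+1)) atTop (𝓝 (Gamma (α+1) - 2*b*(0 * Gamma (2*α+1))
        - 0 * Gamma (3*α+1))) :=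
      ((((tendsto_rpow_neg_atTop hα).mul_const _).const_mul _).const_sub _).sub
        ((tendsto_rpow_neg_atTop (y := 2*α) (by linarith)).mul_const _)
    simp only [zero_mul, mul_zero, sub_zero] at lim
    refine le_of_tendsto lim ?_
    filter_upwards [eventually_ge_atTop t0] with t ht
    exact (P_lower hα hb (ht0.trans_le ht)).trans (anti self_mem_Ici ht ht)
  · right
    set p := t0^(1-α) * L0 α b t0 with hp
    refine ⟨p - Qf α b t0, fun s hs => ?_⟩
    have hge : ∀ t, 0 < t → t < t0 → Qf α b t0 ≤ Qf α b t := by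
      intro t ht htt
      by_contra hc
      push Not at hc
      exact absurd (Q_key hα hb hε hpos ht htt hc) (by linarith)
    have hle : ∀ t, t0 < t → Qf α b t ≤ Qf α b t0 := by
      intro t ht
      by_contra hc
      push Not at hc
      exact absurd (Q_key hα hb hε hpos ht0 ht hc) (by linarith)
    set δ : ℝ → ℝ := fun s => s^(2*α) * Qf α b t0 - s^(1+α) * L0 α b s with hδ
    have dδ : ∀ s, 0 < s → HasDerivAt δ (2*α*s^(2*α-1) * (Qf α b t0 - Qf α b s)) s := by
      intro s hs
      refine (((Real.hasDerivAt_rpow_const (p := 2*α) (Or.inl hs.ne')).mul_const _).fun_sub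
        (dP hα hb hs)).congr_deriv ?_
      ring
    have hmin : δ t0 ≤ δ s := by
      rcases le_total s t0 with h | h
      · have anti : AntitoneOn δ (Icc s t0) := by
          refine antitoneOn_of_deriv_nonpos (convex_Icc _ _)
            (fun t ht => (dδ t (hs.trans_le ht.1)).continuousAt.continuousWithinAt) ?_ ?_
          · rw [interior_Icc]
            exact fun t ht => (dδ t (hs.trans ht.1)).differentiableAt.differentiableWithinAt
          · rw [interior_Icc]; intro t ht; rw [(dδ t (hs.trans ht.1)).deriv]
            have := rpow_pos_of_pos (hs.trans ht.1) (2*α-1)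
            exact mul_nonpos_of_nonneg_of_nonpos (by positivity)
              (by linarith [hge t (hs.trans ht.1) ht.2])
        exact anti ⟨le_refl _, h⟩ ⟨h, le_refl _⟩ h
      · have mono : MonotoneOn δ (Icc t0 s) := by
          refine monotoneOn_of_deriv_nonneg (convex_Icc _ _)
            (fun t ht => (dδ t (ht0.trans_le ht.1)).continuousAt.continuousWithinAt) ?_ ?_
          · rw [interior_Icc]
            exact fun t ht => (dδ t (ht0.trans ht.1)).differentiableAt.differentiableWithinAt
          · rw [interior_Icc]; intro t ht; rw [(dδ t (ht0.trans ht.1)).deriv]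
            have := rpow_pos_of_pos (ht0.trans ht.1) (2*α-1)
            exact mul_nonneg (by positivity) (by linarith [hle t ht.1])
        exact mono ⟨le_refl _, h⟩ ⟨h, le_refl _⟩ h
    simp only [hδ] at hmin
    have es : s^(1+α) = s^(2*α) * s^(1-α) := by rw [← rpow_add hs]; congr 1; ring
    have et : t0^(1+α) = t0^(2*α) * t0^(1-α) := by rw [← rpow_add ht0]; congr 1; ring
    rw [es, et, mul_assoc (t0^(2*α)), ← hp] at hmin
    rw [div_rpow ht0.le hs.le]
    have hs2 : 0 < s^(2*α) := rpow_pos_of_pos hs _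
    have : s^(2*α) * (s^(1-α) * L0 α b s) ≤ s^(2*α) * (p + (p - Qf α b t0) * (t0^(2*α) / s^(2*α) - 1)) := by
      have e : s^(2*α) * (p + (p - Qf α b t0) * (t0^(2*α) / s^(2*α) - 1)) =
        s^(2*α) * Qf α b t0 + (p - Qf α b t0) * t0^(2*α) := by field_simp; ring
      rw [e]; linarith
    exact le_of_mul_le_mul_left this hs2
end

noncomputable def hc (α : ℝ) (z : ℂ) : ℂ := (1 + Complex.exp (α * z))⁻¹

noncomputable def gc (α y : ℝ) (z : ℂ) : ℂ :=
  dslope (hc α) (y:ℂ) z * Complex.exp z / dslope Complex.exp (y:ℂ) z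

lemma one_add_exp_ne {w : ℂ} (h : |w.im| < π) : 1 + Complex.exp w ≠ 0 := by
  intro h0
  have h1 : Complex.exp w = Complex.exp (π * Complex.I) := by
    rw [Complex.exp_pi_mul_I]; linear_combination h0
  obtain ⟨n, hn⟩ := Complex.exp_eq_exp_iff_exists_int.1 h1
  have h2 := congrArg Complex.im hn
  simp at h2
  rw [h2] at h
  have h3 := abs_lt.1 h
  have hpi := Real.pi_pos
  have h4 : (n:ℝ) < 0 := by
    by_contra hcon
    push Not at hcon
    nlinarith [h3.2]
  have h5 : (-1:ℝ) < n := by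
    by_contra hcon
    push Not at hcon
    nlinarith [h3.1]
  have h6 : n < 0 := by exact_mod_cast h4
  have h7 : -1 < n := by exact_mod_cast h5
  omega

lemma exp_ne_of {y : ℝ} {z : ℂ} (h : |z.im| < 2*π) (hz : z ≠ y) :
    Complex.exp z ≠ Complex.exp y := by
  intro h1
  obtain ⟨n, hn⟩ := Complex.exp_eq_exp_iff_exists_int.1 h1
  have h2 := congrArg Complex.im hn
  simp at h2
  rw [h2] at h
  have h3 := abs_lt.1 h
  have hpi := Real.pi_pos
  have h4 : (n:ℝ) < 1 := by
    by_contra hcon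
    push Not at hcon
    nlinarith [h3.2]
  have h5 : (-1:ℝ) < n := by
    by_contra hcon
    push Not at hcon
    nlinarith [h3.1]
  have h6 : n < 1 := by exact_mod_cast h4
  have h7 : -1 < n := by exact_mod_cast h5
  have : n = 0 := by omega
  subst this
  apply hz
  simpa using hn

lemma gc_eq {α y : ℝ} {z : ℂ} (hz : z ≠ y) (h : |z.im| < 2*π) :
    gc α y z = (hc α z - hc α y) * (Complex.exp z / (Complex.exp z - Complex.exp y)) := by
  unfold gc
  rw [dslope_of_ne _ hz, dslope_of_ne _ hz, slope_def_field, slope_def_field]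
  have h1 : z - y ≠ 0 := sub_ne_zero.2 hz
  have h2 : Complex.exp z - Complex.exp y ≠ 0 := sub_ne_zero.2 (exp_ne_of h hz)
  field_simp

lemma gc_diff {α : ℝ} (hα : α ∈ Ioo (0:ℝ) 1) (y : ℝ) :
    DifferentiableOn ℂ (gc α y) {z | |z.im| ≤ π} := by
  have hpi := Real.pi_pos
  have hcont : Continuous (fun z : ℂ => z.im) := Complex.continuous_im
  set U : Set ℂ := {z | |α * z.im| < π ∧ |z.im| < 2*π} with hU
  have hUo : IsOpen U := by
    apply IsOpen.inter
    · exact isOpen_lt (f := fun z : ℂ => |α * z.im|) (by fun_prop) continuous_const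
    · exact isOpen_lt (f := fun z : ℂ => |z.im|) (by fun_prop) continuous_const
  have hyU : (y:ℂ) ∈ U := by
    simp [hU, hpi]
  have hn : U ∈ 𝓝 (y:ℂ) := hUo.mem_nhds hyU
  have h1 : DifferentiableOn ℂ (hc α) U := by
    intro z hz
    apply DifferentiableAt.differentiableWithinAt
    unfold hc
    apply DifferentiableAt.inv
    · fun_prop
    · apply one_add_exp_ne
      simpa using hz.1
  have h2 := (Complex.differentiableOn_dslope hn).2 h1
  have h3 := (Complex.differentiableOn_dslope hn).2 (Complex.differentiable_exp.differentiableOn)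
  have h4 : ∀ z ∈ U, dslope Complex.exp (y:ℂ) z ≠ 0 := by
    intro z hz
    by_cases hzy : z = y
    · subst hzy
      rw [dslope_same]
      simp
    · rw [dslope_of_ne _ hzy, slope_def_field]
      exact div_ne_zero (sub_ne_zero.2 (exp_ne_of hz.2 hzy)) (sub_ne_zero.2 hzy)
  have h5 : DifferentiableOn ℂ (gc α y) U :=
    (h2.mul Complex.differentiable_exp.differentiableOn).div h3 h4
  apply h5.mono
  intro z hz
  simp only [mem_ofPred_eq] at hz
  refine ⟨?_, by linarith⟩
  rw [abs_mul, abs_of_pos hα.1]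
  have := hα.2
  have := abs_nonneg z.im
  nlinarith [hα.1]

lemma gc_rect {α : ℝ} (hα : α ∈ Ioo (0:ℝ) 1) (y T : ℝ) :
    (∫ x : ℝ in (-T)..T, gc α y (x + (-π:ℝ) * Complex.I)) - (∫ x : ℝ in (-T)..T, gc α y (x + π * Complex.I))
     + Complex.I * (∫ v : ℝ in (-π)..π, gc α y (T + v * Complex.I))
     - Complex.I * (∫ v : ℝ in (-π)..π, gc α y ((-T:ℝ) + v * Complex.I)) = 0 := by
  have := Complex.integral_boundary_rect_eq_zero_of_differentiableOn (gc α y)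
    ((-T:ℝ) + (-π:ℝ) * Complex.I) ((T:ℝ) + (π:ℝ) * Complex.I) ?_
  · simpa using this
  · apply (gc_diff hα y).mono
    intro z hz
    have h2 := hz.2
    have hpi := Real.pi_pos
    simp at h2
    rw [uIcc_of_le (by linarith)] at h2
    exact abs_le.2 h2

lemma hc_norm_le {α : ℝ} {z : ℂ} (h : 0 < rexp (α * z.re) - 1) :
    ‖hc α z‖ ≤ (rexp (α * z.re) - 1)⁻¹ := by
  unfold hc
  rw [norm_inv]
  apply inv_anti₀ h
  have := norm_sub_norm_le (Complex.exp (α*z)) (-1)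
  rw [Complex.norm_exp] at this
  simp at this
  rw [add_comm]
  simpa using this

lemma hc_norm_le' {α : ℝ} {z : ℂ} (h : 0 < 1 - rexp (α * z.re)) :
    ‖hc α z‖ ≤ (1 - rexp (α * z.re))⁻¹ := by
  unfold hc
  rw [norm_inv]
  apply inv_anti₀ h
  have := norm_sub_norm_le (1:ℂ) (-Complex.exp (α*z))
  rw [norm_neg, Complex.norm_exp] at this
  simpa using this

lemma tendsto_right {α : ℝ} (hα : α ∈ Ioo (0:ℝ) 1) (y : ℝ) :
    Tendsto (fun T : ℝ => ∫ v : ℝ in (-π)..π, gc α y (T + v * Complex.I)) atTop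
      (𝓝 (∫ _v : ℝ in (-π)..π, - hc α y)) := by
  have hpi := Real.pi_pos
  have hE : Tendsto (fun T : ℝ => rexp T) atTop atTop := Real.tendsto_exp_atTop
  have hEa : Tendsto (fun T : ℝ => rexp (α*T)) atTop atTop :=
    Real.tendsto_exp_atTop.comp (tendsto_id.const_mul_atTop hα.1)
  set B : ℝ → ℝ := fun T => (rexp (α*T) - 1)⁻¹ * (1 + rexp y * (rexp T - rexp y)⁻¹)
    + ‖hc α y‖ * (rexp y * (rexp T - rexp y)⁻¹) with hB
  have hB0 : Tendsto B atTop (𝓝 0) := by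
    have a1 : Tendsto (fun T => (rexp (α*T) - 1)⁻¹) atTop (𝓝 0) :=
      tendsto_inv_atTop_zero.comp (tendsto_atTop_add_const_right _ (-1) hEa)
    have a2 : Tendsto (fun T => (rexp T - rexp y)⁻¹) atTop (𝓝 0) :=
      tendsto_inv_atTop_zero.comp (tendsto_atTop_add_const_right _ (-rexp y) hE)
    have := (a1.mul ((a2.const_mul (rexp y)).const_add 1)).add ((a2.const_mul (rexp y)).const_mul (‖hc α y‖))
    simpa using this
  have hcontG : ∀ T : ℝ, IntervalIntegrable (fun v : ℝ => gc α y (T + v * Complex.I)) volume (-π) π := by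
    intro T
    apply ContinuousOn.intervalIntegrable
    apply (gc_diff hα y).continuousOn.comp (by fun_prop)
    intro v hv
    rw [uIcc_of_le (by linarith)] at hv
    simpa using abs_le.2 hv
  rw [tendsto_iff_norm_sub_tendsto_zero]
  have hB1 : Tendsto (fun T => B T * |π - (-π)|) atTop (𝓝 0) := by simpa using hB0.mul_const (|π - (-π)|)
  refine squeeze_zero' (Eventually.of_forall fun _ => norm_nonneg _) ?_ hB1
  filter_upwards [eventually_gt_atTop y, eventually_gt_atTop 0] with T hT hT0
  rw [← intervalIntegral.integral_sub (hcontG T) (by simp)]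
  apply intervalIntegral.norm_integral_le_of_norm_le_const
  intro v hv
  rw [uIoc_of_le (by linarith)] at hv
  set z : ℂ := T + v * Complex.I with hz
  have zre : z.re = T := by simp [hz]
  have zim : z.im = v := by simp [hz]
  have hzy : z ≠ y := by
    intro h
    have := congrArg Complex.re h
    simp [zre] at this
    linarith
  have hv2 : |z.im| < 2*π := by
    rw [zim, abs_lt]; constructor <;> linarith [hv.1, hv.2]
  rw [gc_eq hzy hv2]
  have hne : Complex.exp z - Complex.exp y ≠ 0 := sub_ne_zero.2 (exp_ne_of hv2 hzy)
  have hq : rexp T - rexp y ≤ ‖Complex.exp z - Complex.exp y‖ := by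
    have := norm_sub_norm_le (Complex.exp z) (Complex.exp y)
    rw [Complex.norm_exp, Complex.norm_exp, zre] at this
    simpa using this
  have hpos : 0 < rexp T - rexp y := by have := Real.exp_lt_exp.2 hT; linarith
  set D := Complex.exp y / (Complex.exp z - Complex.exp y) with hD
  have hDn : ‖D‖ ≤ rexp y * (rexp T - rexp y)⁻¹ := by
    rw [hD, norm_div, Complex.norm_exp, div_eq_mul_inv]
    simp only [Complex.ofReal_re]
    gcongr
  have heq : Complex.exp z / (Complex.exp z - Complex.exp y) = 1 + D := by
    rw [hD]; field_simp; ring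
  rw [heq]
  have : (hc α z - hc α y) * (1 + D) - - hc α y = hc α z * (1 + D) - hc α y * D := by ring
  rw [this]
  have hn : ‖hc α z‖ ≤ (rexp (α*T) - 1)⁻¹ := by
    have := hc_norm_le (α := α) (z := z) ?_
    · rwa [zre] at this
    · rw [zre]
      have : 0 < α * T := mul_pos hα.1 hT0
      have := Real.add_one_lt_exp this.ne'
      linarith
  calc _ ≤ ‖hc α z * (1 + D)‖ + ‖hc α y * D‖ := norm_sub_le _ _
    _ ≤ ‖hc α z‖ * (1 + ‖D‖) + ‖hc α y‖ * ‖D‖ := by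
      rw [norm_mul, norm_mul]
      gcongr
      exact (norm_add_le _ _).trans (by simp)
    _ ≤ B T := by
      rw [hB]
      dsimp only
      have := norm_nonneg (hc α z)
      gcongr
      exact this.trans hn

lemma tendsto_left {α : ℝ} (hα : α ∈ Ioo (0:ℝ) 1) (y : ℝ) :
    Tendsto (fun T : ℝ => ∫ v : ℝ in (-π)..π, gc α y ((-T:ℝ) + v * Complex.I)) atTop (𝓝 0) := by
  have hpi := Real.pi_pos
  have hE : Tendsto (fun T : ℝ => rexp (-T)) atTop (𝓝 0) := Real.tendsto_exp_neg_atTop_nhds_zero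
  have hEa : Tendsto (fun T : ℝ => rexp (α*(-T))) atTop (𝓝 0) := by
    have := Real.tendsto_exp_neg_atTop_nhds_zero.comp (tendsto_id.const_mul_atTop hα.1)
    refine this.congr fun T => ?_
    simp
  set B : ℝ → ℝ := fun T => ((1 - rexp (α*(-T)))⁻¹ + ‖hc α y‖) * (rexp (-T) * (rexp y - rexp (-T))⁻¹) with hB
  have hB0 : Tendsto B atTop (𝓝 0) := by
    have a1 : Tendsto (fun T => (1 - rexp (α*(-T)))⁻¹) atTop (𝓝 (1-0)⁻¹) :=
      (hEa.const_sub 1).inv₀ (by norm_num)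
    have a2 : Tendsto (fun T => (rexp y - rexp (-T))⁻¹) atTop (𝓝 (rexp y - 0)⁻¹) :=
      (hE.const_sub _).inv₀ (by simp)
    have := (a1.add_const (‖hc α y‖)).mul (hE.mul a2)
    rw [zero_mul, mul_zero] at this
    exact this
  rw [tendsto_zero_iff_norm_tendsto_zero]
  have hB1 : Tendsto (fun T => B T * |π - (-π)|) atTop (𝓝 0) := by simpa using hB0.mul_const (|π - (-π)|)
  refine squeeze_zero' (Eventually.of_forall fun _ => norm_nonneg _) ?_ hB1
  filter_upwards [eventually_gt_atTop (-y), eventually_gt_atTop 0] with T hT hT0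
  apply intervalIntegral.norm_integral_le_of_norm_le_const
  intro v hv
  rw [uIoc_of_le (by linarith)] at hv
  set z : ℂ := (-T:ℝ) + v * Complex.I with hz
  have zre : z.re = -T := by simp [hz]
  have zim : z.im = v := by simp [hz]
  have hzy : z ≠ y := by
    intro h
    have := congrArg Complex.re h
    simp [zre] at this
    linarith
  have hv2 : |z.im| < 2*π := by
    rw [zim, abs_lt]; constructor <;> linarith [hv.1, hv.2]
  rw [gc_eq hzy hv2]
  have hq : rexp y - rexp (-T) ≤ ‖Complex.exp z - Complex.exp y‖ := by
    have := norm_sub_norm_le (Complex.exp y) (Complex.exp z)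
    rw [Complex.norm_exp, Complex.norm_exp, zre, norm_sub_rev] at this
    simpa using this
  have hpos : 0 < rexp y - rexp (-T) := by
    have := Real.exp_lt_exp.2 (show -T < y by linarith); linarith
  have hn : ‖hc α z‖ ≤ (1 - rexp (α*(-T)))⁻¹ := by
    have := hc_norm_le' (α := α) (z := z) ?_
    · rwa [zre] at this
    · rw [zre]
      have : 0 < α * T := mul_pos hα.1 hT0
      have := Real.exp_lt_one_iff.2 (show α * (-T) < 0 by linarith)
      linarith
  rw [norm_mul, norm_div, Complex.norm_exp, zre, div_eq_mul_inv]
  rw [hB]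
  dsimp only
  have h0 := (norm_nonneg (hc α z)).trans hn
  gcongr
  exact (norm_sub_le _ _).trans (by linarith)

lemma hc_diff {α : ℝ} (hα : α ∈ Ioo (0:ℝ) 1) (x : ℝ) :
    hc α (x + (-π:ℝ) * Complex.I) - hc α (x + π * Complex.I)
      = (2 * π * Complex.I) * ((sin (π*α) / π * k0 (cos (π*α)) (rexp (α*x)) : ℝ) : ℂ) := by
  have hpi := Real.pi_pos
  have hb : |cos (π*α)| < 1 := by
    rw [abs_lt]
    constructor
    · rw [← Real.cos_pi]
      apply Real.cos_lt_cos_of_nonneg_of_le_pi <;> nlinarith [hα.1, hα.2]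
    · rw [← Real.cos_zero]
      apply Real.cos_lt_cos_of_nonneg_of_le_pi <;> nlinarith [hα.1, hα.2]
  have n1 : 1 + Complex.exp (α * (x + (-π:ℝ) * Complex.I)) ≠ 0 := by
    apply one_add_exp_ne
    simp
    rw [abs_of_pos hα.1, abs_of_pos hpi]; nlinarith [hα.2]
  have n2 : 1 + Complex.exp (α * (x + π * Complex.I)) ≠ 0 := by
    apply one_add_exp_ne
    simp
    rw [abs_of_pos hα.1, abs_of_pos hpi]; nlinarith [hα.2]
  unfold hc
  set w := rexp (α*x) with hw
  have hwp : 0 < w := Real.exp_pos _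
  have hD := kD_pos hb hwp.le
  set c := cos (π*α)
  set s := sin (π*α)
  have hcs : c^2 + s^2 = 1 := Real.cos_sq_add_sin_sq _
  have e2 : Complex.exp (α * (x + π * Complex.I)) = w * (c + s * Complex.I) := by
    have : (α * (x + π * Complex.I) : ℂ) = ((α*x : ℝ):ℂ) + ((π*α:ℝ):ℂ) * Complex.I := by push_cast; ring
    rw [this, Complex.exp_add, Complex.exp_mul_I, ← Complex.ofReal_exp, ← Complex.ofReal_cos, ← Complex.ofReal_sin]
  have e1 : Complex.exp (α * (x + (-π:ℝ) * Complex.I)) = w * (c - s * Complex.I) := by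
    have : (α * (x + (-π:ℝ) * Complex.I) : ℂ) = ((α*x : ℝ):ℂ) + ((-(π*α):ℝ):ℂ) * Complex.I := by push_cast; ring
    rw [this, Complex.exp_add, Complex.exp_mul_I, ← Complex.ofReal_exp, ← Complex.ofReal_cos, ← Complex.ofReal_sin, Real.cos_neg, Real.sin_neg, Complex.ofReal_neg]
    change (w:ℂ) * (c + -s * Complex.I) = _
    ring
  rw [e1] at n1 ⊢
  rw [e2] at n2 ⊢
  have hDc : (kD c w : ℂ) = (1 + w * (c - s * Complex.I)) * (1 + w * (c + s * Complex.I)) := by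
    have hcs' : (c:ℂ)^2 + s^2 = 1 := by exact_mod_cast hcs
    unfold kD
    push_cast
    linear_combination (-w^2 : ℂ) * hcs' + (-w^2*s^2 : ℂ) * (-1) * Complex.I_sq
  have hpc : (π:ℂ) ≠ 0 := by exact_mod_cast hpi.ne'
  unfold k0
  push_cast
  rw [hDc]
  field_simp
  ring

lemma stieltjes_lim {α : ℝ} (hα : α ∈ Ioo (0:ℝ) 1) (y : ℝ) :
    Tendsto (fun T : ℝ => ∫ x in (-T)..T, (sin (π*α) / π * k0 (cos (π*α)) (rexp (α*x))) * (rexp x / (rexp x + rexp y)))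
      atTop (𝓝 (1 + rexp (α*y))⁻¹) := by
  have hpi := Real.pi_pos
  have hpc : (π:ℂ) ≠ 0 := by exact_mod_cast hpi.ne'
  have hcont : ∀ u : ℝ, |u| ≤ π → ∀ T : ℝ, IntervalIntegrable (fun x : ℝ => gc α y (x + u * Complex.I)) volume (-T) T := by
    intro u hu T
    apply ContinuousOn.intervalIntegrable
    apply (gc_diff hα y).continuousOn.comp (by fun_prop)
    intro v hv
    simpa using hu
  have key : ∀ T : ℝ, (((∫ x in (-T)..T, (sin (π*α) / π * k0 (cos (π*α)) (rexp (α*x))) * (rexp x / (rexp x + rexp y))) : ℝ) : ℂ)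
      = (2*π:ℂ)⁻¹ * ((∫ v : ℝ in (-π)..π, gc α y ((-T:ℝ) + v * Complex.I)) - (∫ v : ℝ in (-π)..π, gc α y (T + v * Complex.I))) := by
    intro T
    have h := gc_rect hα y T
    rw [← intervalIntegral.integral_sub (hcont (-π) (by simp [abs_of_pos hpi]) T) (hcont π (by simp [abs_of_pos hpi]) T)] at h
    have h2 : ∀ x : ℝ, gc α y (x + (-π:ℝ) * Complex.I) - gc α y (x + π * Complex.I)
        = (2 * π * Complex.I) * (((sin (π*α) / π * k0 (cos (π*α)) (rexp (α*x))) * (rexp x / (rexp x + rexp y)) : ℝ) : ℂ) := by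
      intro x
      have hx1 : (x + (-π:ℝ) * Complex.I : ℂ) ≠ y := by
        intro h
        have := congrArg Complex.im h
        simp at this
      have hx2 : (x + π * Complex.I : ℂ) ≠ y := by
        intro h
        have := congrArg Complex.im h
        simp at this
      rw [gc_eq hx1 (by simp [abs_of_pos hpi]; linarith), gc_eq hx2 (by simp [abs_of_pos hpi]; linarith)]
      have e1 : Complex.exp (x + (-π:ℝ) * Complex.I) = -(rexp x : ℂ) := by
        rw [Complex.exp_add]
        have : Complex.exp ((-π:ℝ) * Complex.I) = -1 := by
          push_cast
          rw [neg_mul, Complex.exp_neg, Complex.exp_pi_mul_I]; norm_num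
        rw [this, Complex.ofReal_exp]; ring
      have e2 : Complex.exp (x + π * Complex.I) = -(rexp x : ℂ) := by
        rw [Complex.exp_add, Complex.exp_pi_mul_I, Complex.ofReal_exp]; ring
      rw [e1, e2, ← sub_mul]
      have e3 : (hc α (x + (-π:ℝ) * Complex.I) - hc α y - (hc α (x + π * Complex.I) - hc α y)) = hc α (x + (-π:ℝ) * Complex.I) - hc α (x + π * Complex.I) := by ring
      rw [e3, hc_diff hα, Complex.ofReal_mul (_ * _) (_ / _), mul_assoc]
      congr 2
      rw [← Complex.ofReal_exp y]
      have : (rexp x + rexp y) ≠ 0 := by positivity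
      have h3 : ((rexp x : ℂ) + rexp y) ≠ 0 := by exact_mod_cast this
      have h4 : (-(rexp x : ℂ) - rexp y) ≠ 0 := by
        intro h; apply h3; linear_combination -h
      rw [Complex.ofReal_div, Complex.ofReal_add, div_eq_div_iff h4 h3]
      ring
    rw [intervalIntegral.integral_congr (fun x _ => h2 x), intervalIntegral.integral_const_mul, intervalIntegral.integral_ofReal] at h
    have h5 : Complex.I * ((2*π) * (((∫ x in (-T)..T, (sin (π*α) / π * k0 (cos (π*α)) (rexp (α*x))) * (rexp x / (rexp x + rexp y))) : ℝ) : ℂ)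
       - ((∫ v : ℝ in (-π)..π, gc α y ((-T:ℝ) + v * Complex.I)) - (∫ v : ℝ in (-π)..π, gc α y (T + v * Complex.I)))) = 0 := by
      linear_combination h
    have h6 := (mul_eq_zero.1 h5).resolve_left Complex.I_ne_zero
    have h7 : (2*π:ℂ) ≠ 0 := by simp [hpi.ne']
    rw [eq_inv_mul_iff_mul_eq₀ h7]
    linear_combination h6
  have hl := (((tendsto_left hα y).sub (tendsto_right hα y)).const_mul ((2*π:ℂ)⁻¹))
  have hl2 := hl.congr (fun T => (key T).symm)
  have hre := (Complex.continuous_re.tendsto _).comp hl2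
  have hval : ((2*π:ℂ)⁻¹ * (0 - ∫ v : ℝ in (-π)..π, - hc α y)) = (((1 + rexp (α*y))⁻¹ : ℝ) : ℂ) := by
    rw [intervalIntegral.integral_const]
    have : hc α y = (((1 + rexp (α*y))⁻¹ : ℝ) : ℂ) := by
      unfold hc; push_cast; rfl
    rw [this, Complex.real_smul]
    push_cast
    field_simp
    ring
  rw [hval, Complex.ofReal_re] at hre
  exact hre

lemma stieltjes {α : ℝ} (hα : α ∈ Ioo (0:ℝ) 1) {p : ℝ} (hp : 0 < p) :
    IntegrableOn (fun r => k0 (cos (π*α)) (r^α) / (r + p)) (Ioi 0) ∧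
    sin (π*α) / π * (∫ r in Ioi 0, k0 (cos (π*α)) (r^α) / (r + p)) = (1 + p^α)⁻¹ := by
  have hpi := Real.pi_pos
  have hb : |cos (π*α)| < 1 := by
    rw [abs_lt]
    constructor
    · rw [← Real.cos_pi]
      apply Real.cos_lt_cos_of_nonneg_of_le_pi <;> nlinarith [hα.1, hα.2]
    · rw [← Real.cos_zero]
      apply Real.cos_lt_cos_of_nonneg_of_le_pi <;> nlinarith [hα.1, hα.2]
  have hs : 0 < sin (π*α) := Real.sin_pos_of_pos_of_lt_pi (mul_pos hpi hα.1) (by nlinarith [hα.2])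
  have hlim := stieltjes_lim hα (Real.log p)
  rw [Real.exp_log hp] at hlim
  set g : ℝ → ℝ := fun x => (sin (π*α) / π * k0 (cos (π*α)) (rexp (α*x))) * (rexp x / (rexp x + p)) with hg
  have hgc : Continuous g := by
    have h1 : ∀ x : ℝ, kD (cos (π*α)) (rexp (α*x)) ≠ 0 := fun x => (kD_pos hb (Real.exp_pos _).le).ne'
    have h2 : ∀ x : ℝ, rexp x + p ≠ 0 := fun x => by positivity
    unfold kD at h1
    rw [hg]
    unfold k0 kD
    fun_prop (disch := assumption)
  have hgn : ∀ x, 0 ≤ g x := by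
    intro x
    have := k0_nonneg hb (Real.exp_pos (α*x))
    rw [hg]
    positivity
  have hgi : Integrable g := by
    refine integrable_of_intervalIntegral_norm_tendsto (l := atTop) (a := fun T : ℝ => -T) (b := fun T : ℝ => T) _ (fun T => ?_) tendsto_neg_atTop_atBot tendsto_id (hlim.congr fun T => ?_)
    · exact (hgc.integrableOn_Icc).mono_set Ioc_subset_Icc_self
    · apply intervalIntegral.integral_congr
      intro x _
      exact (Real.norm_of_nonneg (hgn x)).symm
  have hgI : ∫ x, g x = (1 + p^α)⁻¹ := by
    have h1 := intervalIntegral_tendsto_integral hgi tendsto_neg_atTop_atBot tendsto_id (l := (atTop : Filter ℝ))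
    rw [tendsto_nhds_unique h1 hlim, Real.rpow_def_of_pos hp, mul_comm]
  have hcov : ∀ x : ℝ, |rexp x| • (k0 (cos (π*α)) ((rexp x)^α) / (rexp x + p)) = (sin (π*α) / π)⁻¹ * g x := by
    intro x
    rw [hg, abs_of_pos (Real.exp_pos x), ← Real.exp_mul, mul_comm x α]
    simp only [smul_eq_mul]
    field_simp
  have him : rexp '' univ = Ioi 0 := by rw [image_univ, Real.range_exp]
  constructor
  · rw [← him, integrableOn_image_iff_integrableOn_abs_deriv_smul MeasurableSet.univ
      (fun x _ => (Real.hasDerivAt_exp x).hasDerivWithinAt) (Real.exp_injective.injOn)]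
    simp_rw [hcov]
    exact (hgi.const_mul _).integrableOn
  · rw [← him, integral_image_eq_integral_abs_deriv_smul MeasurableSet.univ
      (fun x _ => (Real.hasDerivAt_exp x).hasDerivWithinAt) (Real.exp_injective.injOn)]
    simp_rw [hcov]
    rw [integral_const_mul, setIntegral_univ, hgI]
    field_simp

lemma clap_deriv {f : ℝ → ℝ} (h : ∀ t, 0 < t → IntegrableOn (fun r => rexp (-(r*t)) * f r) (Ioi 0))
    {z : ℂ} (hz : 0 < z.re) :
    DifferentiableAt ℂ (fun z : ℂ => ∫ r in Ioi (0:ℝ), Complex.exp (-(r*z)) * (f r : ℂ)) z := by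
  have hIntg : ∀ w : ℂ, 0 < w.re → IntegrableOn (fun r : ℝ => Complex.exp (-(r*w)) * (f r : ℂ)) (Ioi 0) := by
    intro w hw
    have h1 := (h w.re hw).ofReal (𝕜 := ℂ)
    have h2 := h1.bdd_mul (c := 1) (f := fun r : ℝ => Complex.exp (-(r*(w.im*Complex.I))))
      (by exact (Continuous.aestronglyMeasurable (by fun_prop))) (ae_of_all _ fun r => ?_)
    · refine h2.congr (ae_of_all _ fun r => ?_)
      simp only [Complex.coe_algebraMap, RCLike.ofReal_mul, Complex.ofReal_exp]
      rw [← mul_assoc, ← Complex.exp_add]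
      congr 2
      conv_rhs => rw [← Complex.re_add_im w]
      push_cast; ring
    · rw [Complex.norm_exp]; simp
  have key := hasDerivAt_integral_of_dominated_loc_of_deriv_le (μ := volume.restrict (Ioi (0:ℝ)))
    (F := fun (z:ℂ) (r:ℝ) => Complex.exp (-(r*z)) * (f r : ℂ)) (F' := fun z r => -(r * (Complex.exp (-(r*z)) * (f r : ℂ))))
    (x₀ := z) (s := {w : ℂ | z.re/2 < w.re}) (bound := fun r => ‖rexp (-(r*(z.re/2))) * (r * f r)‖)
    ((isOpen_lt continuous_const Complex.continuous_re).mem_nhds (by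
      change z.re/2 < z.re
      linarith)) ?_ (hIntg z hz) ?_ ?_ ?_ ?_
  · exact key.2.differentiableAt
  · filter_upwards [(isOpen_lt continuous_const Complex.continuous_re).mem_nhds hz] with w hw
    exact (hIntg w hw).aestronglyMeasurable
  · have h1 := (hIntg z hz).aestronglyMeasurable
    have h2 : AEStronglyMeasurable (fun r : ℝ => -(r:ℂ)) (volume.restrict (Ioi (0:ℝ))) :=
      Continuous.aestronglyMeasurable (by fun_prop)
    refine (h2.mul h1).congr (ae_of_all _ fun r => ?_)
    simp only [Pi.mul_apply]; ring
  · filter_upwards [ae_restrict_mem measurableSet_Ioi] with r hr x hx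
    have hr : 0 < r := hr
    have hx : z.re/2 < x.re := hx
    rw [norm_neg, norm_mul, norm_mul, norm_mul, norm_mul, Complex.norm_exp, Complex.norm_real, Complex.norm_real,
      Real.norm_of_nonneg (exp_pos _).le]
    have : (-(r*x)).re ≤ -(r*(z.re/2)) := by
      simp
      nlinarith
    calc _ = rexp (-(r*x)).re * (‖r‖ * ‖f r‖) := by ring
      _ ≤ _ := by gcongr
  · exact ((lap_deriv h (t := z.re/2) (by linarith)).1).norm
  · filter_upwards with r x hx
    have : HasDerivAt (fun x => Complex.exp (-(r*x)) * (f r:ℂ)) (Complex.exp (-(r*x)) * (-(r*1)) * f r) x :=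
      ((((hasDerivAt_id x).const_mul (r:ℂ)).neg).cexp).mul_const _
    exact this.congr_deriv (by ring)

lemma lap_zero {f : ℝ → ℝ} (hc : ContinuousOn f (Ioi 0))
    (h : ∀ t, 0 < t → IntegrableOn (fun r => rexp (-(r*t)) * f r) (Ioi 0))
    (h0 : ∀ t, 0 < t → Lap f t = 0) {t : ℝ} (ht : 0 < t) : f t = 0 := by
  set Φ : ℂ → ℂ := fun z : ℂ => ∫ r in Ioi (0:ℝ), Complex.exp (-(r*z)) * (f r : ℂ) with hΦ
  set U : Set ℂ := {z | 0 < z.re} with hU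
  have hUo : IsOpen U := isOpen_lt continuous_const Complex.continuous_re
  have hd : DifferentiableOn ℂ Φ U := fun z hz => (clap_deriv h hz).differentiableWithinAt
  have ha : AnalyticOnNhd ℂ Φ U := hd.analyticOnNhd hUo
  have hreal : ∀ p : ℝ, 0 < p → Φ p = 0 := by
    intro p hp
    have := congrArg (fun x : ℝ => (x:ℂ)) (h0 p hp)
    simp only [Lap] at this
    rw [Complex.ofReal_zero] at this
    rw [← this, ← integral_complex_ofReal]
    simp only [hΦ]
    congr 1
    ext r
    push_cast
    rfl
  have hz : EqOn Φ 0 U := by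
    apply ha.eqOn_zero_of_preconnected_of_frequently_eq_zero (z₀ := (1:ℂ))
    · exact (convex_halfSpace_re_gt 0).isPreconnected
    · simp [hU]
    · have h1 : Tendsto (fun x : ℝ => (x:ℂ)) (𝓝[>] (1:ℝ)) (𝓝[≠] (1:ℂ)) := by
        apply tendsto_nhdsWithin_of_tendsto_nhds_of_eventually_within
        · have := Complex.continuous_ofReal.tendsto (1:ℝ)
          exact (tendsto_nhdsWithin_of_tendsto_nhds (by simpa using this))
        · filter_upwards [self_mem_nhdsWithin] with x hx
          have hx : (1:ℝ) < x := hx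
          simp
          exact_mod_cast hx.ne'
      refine h1.frequently (Eventually.frequently ?_)
      filter_upwards [self_mem_nhdsWithin] with x hx
      have hx : (1:ℝ) < x := hx
      exact hreal x (by linarith)
  set g : ℝ → ℂ := (Ioi (0:ℝ)).indicator (fun r => ((rexp (-(r*1)) * f r : ℝ) : ℂ)) with hg
  have gi : Integrable g := by
    rw [hg, integrable_indicator_iff measurableSet_Ioi]
    exact (h 1 one_pos).ofReal
  have gF : FourierTransform.fourier g = 0 := by
    ext w
    rw [Real.fourier_real_eq_integral_exp_smul]
    have h2 := hz (show ((1:ℂ) + (2*π*w:ℝ) * Complex.I) ∈ U by simp [hU])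
    simp only [Pi.zero_apply] at h2 ⊢
    rw [← h2]
    simp only [hΦ]
    rw [← integral_indicator measurableSet_Ioi]
    congr 1
    ext r
    rw [hg]
    by_cases hr : r ∈ Ioi (0:ℝ)
    · rw [indicator_of_mem hr, indicator_of_mem hr, smul_eq_mul]
      push_cast
      rw [← mul_assoc, ← Complex.exp_add]
      congr 2
      ring
    · rw [indicator_of_notMem hr, indicator_of_notMem hr]; simp
  have hct : ContinuousAt g t := by
    have h3 : ContinuousAt (fun r => ((rexp (-(r*1)) * f r : ℝ) : ℂ)) t := by
      have := hc.continuousAt (Ioi_mem_nhds ht)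
      fun_prop
    apply h3.congr
    filter_upwards [Ioi_mem_nhds ht] with r hr
    rw [hg, indicator_of_mem hr]
  have := gi.fourierInv_fourier_eq (by rw [gF]; exact integrable_zero _ _ _) hct
  rw [gF] at this
  have h5 : (FourierTransformInv.fourierInv (0 : ℝ → ℂ)) t = 0 := by
    rw [Real.fourierInv_eq]; simp
  rw [h5, hg, indicator_of_mem (show t ∈ Ioi (0:ℝ) from ht)] at this
  have h6 := this.symm
  rw [Complex.ofReal_eq_zero] at h6
  exact (mul_eq_zero.1 h6).resolve_left (exp_pos _).ne'

lemma lap_L0 {α : ℝ} (hα : α ∈ Ioo (0:ℝ) 1) {p : ℝ} (hp : 0 < p) :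
    IntegrableOn (fun t => rexp (-(t*p)) * (sin (π*α)/π * L0 α (cos (π*α)) t)) (Ioi 0) ∧
    Lap (fun t => sin (π*α)/π * L0 α (cos (π*α)) t) p = (1 + p^α)⁻¹ := by
  obtain ⟨hi, hv⟩ := stieltjes hα hp
  have hpi := Real.pi_pos
  have hb : |cos (π*α)| < 1 := by
    rw [abs_lt]
    constructor
    · rw [← Real.cos_pi]
      apply Real.cos_lt_cos_of_nonneg_of_le_pi <;> nlinarith [hα.1, hα.2]
    · rw [← Real.cos_zero]
      apply Real.cos_lt_cos_of_nonneg_of_le_pi <;> nlinarith [hα.1, hα.2]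
  set b := cos (π*α)
  set μ := volume.restrict (Ioi (0:ℝ)) with hμ
  set H : ℝ → ℝ → ℝ := fun t r => rexp (-(t*p)) * (rexp (-(r*t)) * k0 b (r^α)) with hH
  have hin : ∀ r, 0 < r → IntegrableOn (fun t => H t r) (Ioi 0) ∧ ∫ t in Ioi 0, H t r = k0 b (r^α) / (r+p) := by
    intro r hr
    have e : ∀ t, H t r = k0 b (r^α) * rexp (-((r+p)*t)) := by
      intro t
      rw [hH]
      have : rexp (-((r+p)*t)) = rexp (-(t*p)) * rexp (-(r*t)) := by
        rw [← Real.exp_add]; congr 1; ring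
      dsimp only
      rw [this]; ring
    have hrp : 0 < r + p := by linarith
    constructor
    · simp_rw [e]
      have := (exp_int hrp).const_mul (k0 b (r^α))
      simpa [mul_comm, IntegrableOn] using this
    · simp_rw [e]
      rw [integral_const_mul]
      have := integral_exp_mul_Ioi (a := -(r+p)) (by linarith) 0
      simp only [neg_mul] at this
      rw [this, mul_zero, neg_zero, Real.exp_zero, neg_div_neg_eq]
      field_simp
  have hmeas : AEStronglyMeasurable (Function.uncurry H) (μ.prod μ) := by
    apply Measurable.aestronglyMeasurable
    simp only [hH, Function.uncurry_def, k0, kD]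
    fun_prop
  have hprod : Integrable (Function.uncurry H) (μ.prod μ) := by
    rw [integrable_prod_iff' hmeas]
    constructor
    · filter_upwards [ae_restrict_mem measurableSet_Ioi] with r hr
      exact (hin r hr).1
    · refine hi.congr ?_
      filter_upwards [ae_restrict_mem measurableSet_Ioi] with r hr
      rw [← (hin r hr).2]
      congr 1
      ext t
      have := k0_nonneg hb (Real.rpow_pos_of_pos hr α)
      rw [Real.norm_of_nonneg]
      rfl
      simp only [Function.uncurry, hH]
      positivity
  have e2 : ∀ t, ∫ r, H t r ∂μ = rexp (-(t*p)) * L0 α b t := by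
    intro t
    simp only [hH]
    rw [integral_const_mul]
    rfl
  constructor
  · have := (hprod.integral_prod_left).const_mul (sin (π*α)/π)
    refine this.congr (ae_of_all _ fun t => ?_)
    simp only [Function.uncurry_apply_pair]
    rw [e2]; ring
  · have := integral_integral_swap hprod
    simp_rw [e2] at this
    rw [lap_const_mul, ← hv]
    congr 1
    unfold Lap
    rw [this]
    apply setIntegral_congr_fun measurableSet_Ioi
    intro r hr
    exact (hin r hr).2

lemma gamma_lower {a M : ℝ} (ha : 0 ≤ a) (hM : 0 < M) : M^a * rexp (-M) ≤ Gamma (a+1) := by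
  have h1 := lap_rpow (a := a) (t := 1) (by linarith) one_pos
  rw [one_rpow, one_mul] at h1
  rw [← h1]
  unfold Lap
  have hi := lap_rpow_int (a := a) (t := 1) (by linarith) one_pos
  have hsub : Ioi M ⊆ Ioi (0:ℝ) := Ioi_subset_Ioi hM.le
  have h2 : ∫ r in Ioi M, rexp (-(r*1)) * r^a ≤ ∫ r in Ioi 0, rexp (-(r*1)) * r^a := by
    apply setIntegral_mono_set hi
    · filter_upwards [ae_restrict_mem measurableSet_Ioi] with r hr
      have := rpow_nonneg (show 0 ≤ r from (show 0 < r from hr).le) a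
      simp only [Pi.zero_apply]; positivity
    · exact hsub.eventuallyLE
  refine le_trans ?_ h2
  have h3 : ∫ r in Ioi M, rexp (-r) * M^a = M^a * rexp (-M) := by
    rw [integral_mul_const, integral_exp_neg_Ioi, mul_comm]
  rw [← h3]
  apply setIntegral_mono_on
  · have := (exp_int one_pos).mono_set hsub
    simp only [mul_one] at this
    exact this.mul_const _
  · exact hi.mono_set hsub
  · exact measurableSet_Ioi
  · intro r hr
    rw [mul_one]
    have hr : M < r := hr
    gcongr

noncomputable def cS (α : ℝ) (n : ℕ) : ℝ := Gamma α * (-1)^n / Gamma (α*n+α)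

lemma cS_abs {α : ℝ} (hα : 0 < α) (n : ℕ) : |cS α n| = Gamma α / Gamma (α*n+α) := by
  have h1 := Gamma_pos_of_pos hα
  have h2 : 0 < Gamma (α*n+α) := Gamma_pos_of_pos (by positivity)
  unfold cS
  rw [abs_div, abs_mul, abs_of_pos h1, abs_of_pos h2, abs_pow]; simp

lemma cS_summable {α : ℝ} (hα : 0 < α) {x : ℝ} (hx : 0 ≤ x) : Summable fun n => |cS α n| * x^n := by
  set M : ℝ := (2*x+1)^(1/α) with hM
  have hMp : 0 < M := rpow_pos_of_pos (by linarith) _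
  have hMα : M^α = 2*x+1 := by
    rw [hM, ← rpow_mul (by linarith)]; field_simp; simp
  have hr : ‖x/(2*x+1)‖ < 1 := by
    rw [Real.norm_of_nonneg (by positivity), div_lt_one (by linarith)]; linarith
  have s1 := summable_pow_mul_geometric_of_norm_lt_one 1 hr
  have s0 := summable_geometric_of_norm_lt_one hr
  have s2 := ((s1.add s0).mul_left (Gamma α * α * rexp M * (2*x+1)⁻¹))
  refine Summable.of_nonneg_of_le (fun n => by positivity) (fun n => ?_) s2
  rw [cS_abs hα]
  have h1 := Gamma_pos_of_pos hα
  have ha : 0 < α*n+α := by positivity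
  have h2 : 0 < Gamma (α*n+α) := Gamma_pos_of_pos ha
  have h3 := gamma_lower ha.le hMp
  rw [Gamma_add_one ha.ne'] at h3
  have h4 : M^(α*n+α) = (2*x+1)^n * (2*x+1) := by
    rw [rpow_add hMp, rpow_mul hMp.le, hMα, rpow_natCast]
  rw [h4] at h3
  have h5 : (2*x+1)^n * (2*x+1) ≤ rexp M * ((α*n+α) * Gamma (α*n+α)) := by
    rw [Real.exp_neg] at h3
    have := exp_pos M
    calc (2*x+1)^n * (2*x+1) = rexp M * ((2*x+1)^n * (2*x+1) * (rexp M)⁻¹) := by field_simp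
      _ ≤ _ := by gcongr
  have h6 : 1 / Gamma (α*n+α) ≤ rexp M * (α*n+α) / ((2*x+1)^n * (2*x+1)) := by
    rw [div_le_div_iff₀ h2 (by positivity)]
    linarith
  calc Gamma α / Gamma (α*n+α) * x^n = Gamma α * (1/Gamma (α*n+α)) * x^n := by ring
    _ ≤ Gamma α * (rexp M * (α*n+α) / ((2*x+1)^n * (2*x+1))) * x^n := by gcongr
    _ = _ := by rw [div_pow, pow_one]; field_simp

noncomputable def FS (α x : ℝ) : ℝ := ∑' n : ℕ, cS α n * x^n

lemma FS_hasFP {α : ℝ} (hα : 0 < α) :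
    HasFPowerSeriesOnBall (FS α) (FormalMultilinearSeries.ofScalars ℝ (cS α)) 0 ⊤ := by
  have hr : (FormalMultilinearSeries.ofScalars ℝ (cS α)).radius = ⊤ := by
    apply FormalMultilinearSeries.radius_eq_top_of_summable_norm
    intro r
    simp only [FormalMultilinearSeries.ofScalars_norm]
    exact cS_summable hα r.2
  have h := (FormalMultilinearSeries.ofScalars ℝ (cS α)).hasFPowerSeriesOnBall (by rw [hr]; exact ENNReal.zero_lt_top)
  rw [hr] at h
  convert h using 1
  ext x
  unfold FS
  have := congrFun (FormalMultilinearSeries.ofScalarsSum_eq_tsum (E := ℝ) (cS α)) x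
  simpa [FormalMultilinearSeries.ofScalarsSum] using this.symm

lemma FS_contDiff {α : ℝ} (hα : 0 < α) : ContDiff ℝ 2 (FS α) := by
  have h := (FS_hasFP hα).analyticOnNhd
  have : AnalyticOnNhd ℝ (FS α) univ := h.mono (by simp)
  exact contDiffOn_univ.1 (this.contDiffOn uniqueDiffOn_univ)

lemma FS_deriv {α : ℝ} (hα : 0 < α) : deriv (FS α) 0 < 0 := by
  rw [(FS_hasFP hα).hasFPowerSeriesAt.deriv]
  have h0 := FormalMultilinearSeries.ofScalars_apply_eq (E := ℝ) (cS α) 1 1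
  refine lt_of_eq_of_lt h0 ?_
  have h1 := Gamma_pos_of_pos hα
  have h2 : 0 < Gamma (α*(1:ℕ)+α) := Gamma_pos_of_pos (by push_cast; linarith)
  have : cS α 1 < 0 := by
    unfold cS
    rw [pow_one]
    apply div_neg_of_neg_of_pos _ h2
    linarith
  simpa using this

noncomputable def RS (α t : ℝ) : ℝ := t^(α-1) * FS α (t^α) / Gamma α

lemma RS_lap {α : ℝ} (hα : 0 < α) {p : ℝ} (hp : 1 < p) :
    IntegrableOn (fun t => rexp (-(t*p)) * RS α t) (Ioi 0) ∧ Lap (RS α) p = (1 + p^α)⁻¹ := by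
  have hp0 : 0 < p := by linarith
  have hG := Gamma_pos_of_pos hα
  have hpα : 1 < p^α := one_lt_rpow hp hα
  set f : ℕ → ℝ → ℝ := fun n t => rexp (-(t*p)) * (t^(α-1) * (cS α n * (t^α)^n) / Gamma α) with hf
  have fe : ∀ n t, 0 < t → f n t = ((-1)^n / Gamma (α*n+α)) * (rexp (-(t*p)) * t^(α*n+α-1)) := by
    intro n t ht
    have : t^(α*n+α-1) = t^(α-1) * (t^α)^n := by
      rw [← rpow_natCast, ← rpow_mul ht.le, ← rpow_add ht]; congr 1; ring
    rw [this]
    simp only [hf, cS]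
    field_simp
  have hexp : ∀ n : ℕ, -1 < α*n+α-1 := fun n => by
    have : 0 ≤ α * n := by positivity
    linarith
  have hΓ : ∀ n : ℕ, 0 < Gamma (α*n+α) := fun n => Gamma_pos_of_pos (by positivity)
  have fi : ∀ n, IntegrableOn (f n) (Ioi 0) := by
    intro n
    have := (lap_rpow_int (hexp n) hp0).const_mul ((-1)^n / Gamma (α*n+α))
    exact IntegrableOn.congr_fun this (fun t ht => (fe n t ht).symm) measurableSet_Ioi
  have hv : ∀ n : ℕ, ∫ t in Ioi 0, rexp (-(t*p)) * t^(α*n+α-1) = (p^α)⁻¹ * ((p^α)⁻¹)^n * Gamma (α*n+α) := by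
    intro n
    have := lap_rpow (hexp n) hp0
    unfold Lap at this
    rw [this, sub_add_cancel]
    congr 1
    rw [rpow_neg hp0.le, rpow_add hp0, rpow_mul hp0.le, rpow_natCast, mul_inv, inv_pow, mul_comm]
  have f1 : ∀ n, ∫ t in Ioi 0, f n t = (p^α)⁻¹ * (-(p^α)⁻¹)^n := by
    intro n
    rw [setIntegral_congr_fun measurableSet_Ioi (fun t ht => fe n t ht), integral_const_mul, hv, neg_pow (p^α)⁻¹ n]
    have := (hΓ n).ne'
    field_simp
  have f2 : ∀ n, ∫ t in Ioi 0, ‖f n t‖ = (p^α)⁻¹ * ((p^α)⁻¹)^n := by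
    intro n
    have : ∀ t ∈ Ioi (0:ℝ), ‖f n t‖ = (1/Gamma (α*n+α)) * (rexp (-(t*p)) * t^(α*n+α-1)) := by
      intro t ht
      rw [fe n t ht, norm_mul, norm_div, norm_pow, norm_neg, norm_one, one_pow, Real.norm_of_nonneg (hΓ n).le,
        Real.norm_of_nonneg]
      have := rpow_pos_of_pos ht (α*n+α-1)
      positivity
    rw [setIntegral_congr_fun measurableSet_Ioi this, integral_const_mul, hv]
    have := (hΓ n).ne'
    field_simp
  have hq : |(p^α)⁻¹| < 1 := by
    rw [abs_of_pos (by positivity)]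
    exact inv_lt_one_of_one_lt₀ hpα
  have hs : Summable fun n => ∫ t in Ioi 0, ‖f n t‖ := by
    simp_rw [f2]
    exact (summable_geometric_of_abs_lt_one hq).mul_left _
  have hsum : ∀ t, 0 < t → HasSum (fun n => f n t) (rexp (-(t*p)) * RS α t) := by
    intro t ht
    have h1 : Summable fun n => cS α n * (t^α)^n := by
      apply Summable.of_norm
      refine (cS_summable hα (rpow_nonneg ht.le α)).congr fun n => ?_
      rw [norm_mul, Real.norm_of_nonneg (pow_nonneg (rpow_nonneg ht.le α) n)]; rfl
    exact (((h1.hasSum.mul_left _).div_const _).mul_left _)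
  have hsumn : ∀ t, 0 < t → Summable (fun n => ‖f n t‖) := fun t ht => (hsum t ht).summable.norm
  have H1 := hasSum_integral_of_summable_integral_norm (μ := volume.restrict (Ioi 0)) fi hs
  have H2 := hasSum_integral_of_summable_integral_norm (μ := volume.restrict (Ioi 0)) (F := fun n t => ‖f n t‖)
    (fun n => (fi n).norm) (by simpa using hs)
  have hGi : IntegrableOn (fun t => ∑' n, ‖f n t‖) (Ioi 0) := by
    by_contra hcon
    rw [integral_undef hcon] at H2
    have hpos : ∀ n, 0 < ∫ t in Ioi 0, ‖f n t‖ := fun n => by rw [f2]; positivity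
    have := (H2.summable.tsum_pos (fun n => (hpos n).le) 0 (hpos 0))
    rw [H2.tsum_eq] at this
    exact lt_irrefl _ this
  have hcont : ContinuousOn (fun t => rexp (-(t*p)) * RS α t) (Ioi 0) := by
    have h1 : Continuous (FS α) := (FS_contDiff hα).continuous
    have h2 : ∀ a : ℝ, ContinuousOn (fun t : ℝ => t^a) (Ioi 0) := fun a t ht =>
      (continuousAt_rpow_const t a (Or.inl (ne_of_gt ht))).continuousWithinAt
    unfold RS
    exact (Continuous.continuousOn (by fun_prop)).mul (((h2 _).mul (h1.comp_continuousOn (h2 _))).div_const _)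
  refine ⟨?_, ?_⟩
  · refine Integrable.mono' hGi (hcont.aestronglyMeasurable measurableSet_Ioi) ?_
    filter_upwards [ae_restrict_mem measurableSet_Ioi] with t ht
    rw [← (hsum t ht).tsum_eq]
    exact norm_tsum_le_tsum_norm (hsumn t ht)
  · have e : ∫ t in Ioi 0, ∑' n, f n t = Lap (RS α) p :=
      setIntegral_congr_fun measurableSet_Ioi (fun t ht => (hsum t ht).tsum_eq)
    rw [e] at H1
    simp_rw [f1] at H1
    have H3 := (hasSum_geometric_of_abs_lt_one (r := -(p^α)⁻¹) (by rwa [abs_neg])).mul_left ((p^α)⁻¹)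
    rw [H1.unique H3]
    have : p^α ≠ 0 := by positivity
    have : 1 + p^α ≠ 0 := by positivity
    rw [← mul_inv]
    congr 1
    field_simp
    ring

lemma RS_cont {α : ℝ} (hα : 0 < α) : ContinuousOn (RS α) (Ioi 0) := by
  have h1 : Continuous (FS α) := (FS_contDiff hα).continuous
  have h2 : ∀ a : ℝ, ContinuousOn (fun t : ℝ => t^a) (Ioi 0) := fun a t ht =>
    (continuousAt_rpow_const t a (Or.inl (ne_of_gt ht))).continuousWithinAt
  unfold RS
  exact (((h2 _).mul (h1.comp_continuousOn (h2 _))).div_const _)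

lemma cosb {α : ℝ} (hα : α ∈ Ioo (0:ℝ) 1) : |cos (π*α)| < 1 := by
  have hpi := Real.pi_pos
  rw [abs_lt]
  constructor
  · rw [← Real.cos_pi]
    apply Real.cos_lt_cos_of_nonneg_of_le_pi <;> nlinarith [hα.1, hα.2]
  · rw [← Real.cos_zero]
    apply Real.cos_lt_cos_of_nonneg_of_le_pi <;> nlinarith [hα.1, hα.2]

lemma RS_eq {α : ℝ} (hα : α ∈ Ioo (0:ℝ) 1) {t : ℝ} (ht : 0 < t) :
    RS α t = sin (π*α)/π * L0 α (cos (π*α)) t := by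
  have hb := cosb hα
  have hLc : ContinuousOn (L0 α (cos (π*α))) (Ioi 0) := fun t ht =>
    (lap_deriv (fun t ht => i0 hb ht) ht).2.continuousAt.continuousWithinAt
  have key := lap_zero (f := fun t => rexp (-(t*1)) * (RS α t - sin (π*α)/π * L0 α (cos (π*α)) t)) ?_ ?_ ?_ ht
  · have := (mul_eq_zero.1 key).resolve_left (exp_pos _).ne'
    linarith
  · exact (Continuous.continuousOn (by fun_prop)).mul ((RS_cont hα.1).sub (hLc.const_mul _))
  · intro p hp
    have h1 := (RS_lap hα.1 (p := p+1) (by linarith)).1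
    have h2 := (lap_L0 hα (p := p+1) (by linarith)).1
    refine IntegrableOn.congr_fun (h1.sub h2) (fun t _ => ?_) measurableSet_Ioi
    have : rexp (-(t*(p+1))) = rexp (-(t*p)) * rexp (-(t*1)) := by
      rw [← Real.exp_add]; congr 1; ring
    simp only [Pi.sub_apply]
    rw [this]; ring
  · intro p hp
    obtain ⟨h1, e1⟩ := (RS_lap hα.1 (p := p+1) (by linarith))
    obtain ⟨h2, e2⟩ := (lap_L0 hα (p := p+1) (by linarith))
    have h3 := e1.trans e2.symm
    unfold Lap at h3 ⊢
    rw [← sub_eq_zero, ← integral_sub h1 h2] at h3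
    refine Eq.trans ?_ h3
    refine integral_congr_ae (ae_of_all _ fun t => ?_)
    dsimp only
    have : rexp (-(t*(p+1))) = rexp (-(t*p)) * rexp (-(t*1)) := by
      rw [← Real.exp_add]; congr 1; ring
    rw [this]; ring

lemma FS_rep {α : ℝ} (hα : α ∈ Ioo (0:ℝ) 1) {t : ℝ} (ht : 0 < t) :
    FS α (t^α) = (Gamma (1-α))⁻¹ * (t^(1-α) * L0 α (cos (π*α)) t) := by
  have h := RS_eq hα ht
  have h1 := Gamma_pos_of_pos hα.1
  have h2 : 0 < Gamma (1-α) := Gamma_pos_of_pos (by linarith [hα.2])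
  have h3 := Real.Gamma_mul_Gamma_one_sub α
  have hs : 0 < sin (π*α) := Real.sin_pos_of_pos_of_lt_pi (mul_pos pi_pos hα.1) (by nlinarith [hα.2, pi_pos])
  have h5 : t^(1-α) * t^(α-1) = 1 := by rw [← rpow_add ht]; simp
  have h6 : (Gamma (1-α))⁻¹ = Gamma α * (sin (π*α)/π) := by
    rw [eq_div_iff hs.ne'] at h3
    have := pi_pos
    apply inv_eq_of_mul_eq_one_right
    rw [← mul_div_assoc, ← mul_div_assoc, div_eq_one_iff_eq this.ne']
    linarith
  rw [h6]
  have : Gamma α * (sin (π*α)/π) * (t^(1-α) * L0 α (cos (π*α)) t) = Gamma α * t^(1-α) * RS α t := by rw [h]; ring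
  rw [this]
  unfold RS
  field_simp
  linear_combination (-FS α (t^α)) * h5

lemma ks_eq {α : ℝ} (hα : 0 < α) (x : ℝ) :
    ∑' n : ℕ, (∏ k ∈ Finset.range n, Gamma (1 + α * ((k:ℝ) * 1 + (1 - 1/α))) / Gamma (1 + α * ((k:ℝ) * 1 + (1 - 1/α) + 1))) * (-x)^n
      = FS α x := by
  unfold FS
  congr 1
  ext n
  have : ∀ k ∈ Finset.range n, Gamma (1 + α * ((k:ℝ) * 1 + (1 - 1/α))) / Gamma (1 + α * ((k:ℝ) * 1 + (1 - 1/α) + 1))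
      = (fun k : ℕ => Gamma (α*k+α)) k / (fun k : ℕ => Gamma (α*k+α)) (k+1) := by
    intro k _
    dsimp only
    congr 2
    · field_simp; ring
    · push_cast; field_simp; ring
  have hΓ : ∀ n : ℕ, Gamma (α*n+α) ≠ 0 := fun n => (Gamma_pos_of_pos (by positivity)).ne'
  rw [Finset.prod_congr rfl this]
  have hp : ∀ n : ℕ, ∏ k ∈ Finset.range n, (fun k : ℕ => Gamma (α*k+α)) k / (fun k : ℕ => Gamma (α*k+α)) (k+1)
      = Gamma α / Gamma (α*n+α) := by
    intro n
    induction n with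
    | zero => simp [(Gamma_pos_of_pos hα).ne']
    | succ m ih =>
      rw [Finset.prod_range_succ, ih]
      have h1 := hΓ m
      have h2 := hΓ (m+1)
      dsimp only
      field_simp
  rw [hp, neg_pow]
  unfold cS
  ring

lemma A_int {α : ℝ} (hα : α ∈ Ioo (0:ℝ) 1) {p : ℝ} (hp : 0 < p) :
    IntegrableOn (fun r => rexp (-(r*p)) * r^α * FS α (r^α)) (Ioi 0) ∧
    ∫ r in Ioi 0, rexp (-(r*p)) * r^α * FS α (r^α) = Gamma (1+α) * (p⁻¹ * p^α / (1+p^α)^2) := by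
  have hG := Gamma_pos_of_pos hα.1
  set f : ℝ → ℝ := fun t => sin (π*α)/π * L0 α (cos (π*α)) t with hf
  have hi : ∀ t, 0 < t → IntegrableOn (fun r => rexp (-(r*t)) * f r) (Ioi 0) := fun t ht => (lap_L0 hα ht).1
  obtain ⟨h1, h2⟩ := lap_deriv hi hp
  have e : ∀ r ∈ Ioi (0:ℝ), rexp (-(r*p)) * r^α * FS α (r^α) = Gamma α * (rexp (-(r*p)) * (r * f r)) := by
    intro r hr
    have hr : 0 < r := hr
    have : f r = RS α r := (RS_eq hα hr).symm
    rw [this]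
    unfold RS
    have h3 : r * r^(α-1) = r^α := by
      rw [rpow_sub_one hr.ne']; field_simp
    rw [← h3]
    field_simp
  have hd : HasDerivAt (Lap f) (-(p⁻¹ * (α * p^α)) / (1+p^α)^2) p := by
    have h4 : HasDerivAt (fun p : ℝ => (1+p^α)⁻¹) (-(α * p^(α-1)) / (1+p^α)^2) p := by
      have := ((hasDerivAt_rpow_const (p := α) (Or.inl hp.ne')).const_add 1).fun_inv (x := p) (by positivity)
      exact this
    rw [rpow_sub_one hp.ne'] at h4
    refine (h4.congr_of_eventuallyEq ?_).congr_deriv ?_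
    · filter_upwards [lt_mem_nhds hp] with t ht
      exact (lap_L0 hα ht).2
    · field_simp
  have hv := h2.unique hd
  refine ⟨IntegrableOn.congr_fun (Integrable.const_mul h1 (Gamma α)) (fun r hr => (e r hr).symm) measurableSet_Ioi, ?_⟩
  rw [setIntegral_congr_fun measurableSet_Ioi e, integral_const_mul]
  change Gamma α * Lap (fun r => r * f r) p = _
  rw [add_comm 1 α, Gamma_add_one hα.1.ne']
  have : Lap (fun r => r * f r) p = (p⁻¹ * (α * p^α)) / (1+p^α)^2 := by
    rw [neg_div] at hv; linarith
  rw [this]; ring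

lemma FS_bound {α x : ℝ} (hα : α ∈ Ioo (0:ℝ) 1) (hx : 0 < x) :
    ((1 + sqrt (Gamma (1-α) / Gamma (1+α)) * x)^2)⁻¹ ≤ FS α x := by
  have hα0 := hα.1
  have hα1 := hα.2
  have g1 : 0 < Gamma (1-α) := Gamma_pos_of_pos (by linarith)
  have g2 : 0 < Gamma (1+α) := Gamma_pos_of_pos (by linarith)
  set c := sqrt (Gamma (1-α) / Gamma (1+α)) with hc
  have hcp : 0 < c := sqrt_pos.2 (by positivity)
  have hc2 : c^2 * Gamma (1+α) = Gamma (1-α) := by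
    rw [hc, sq_sqrt (by positivity)]; field_simp
  set t0 := x^(1/α) with ht0
  have ht0p : 0 < t0 := rpow_pos_of_pos hx _
  have ht0α : t0^α = x := by
    rw [ht0, ← rpow_mul hx.le]; field_simp; simp
  have hb := cosb hα
  obtain ⟨ε, hε, hpos⟩ := LG_pos_near hα0 hb (inv_pos.2 g1) (FS_contDiff hα0) (FS_deriv hα0) (fun t ht => FS_rep hα ht)
  have hrep0 := FS_rep hα ht0p
  rw [ht0α] at hrep0
  rcases dichotomy hα0 hb hε hpos ht0p with h | ⟨q, hq⟩
  · have e1 : t0^(1+α) = t0^(1-α) * x^2 := by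
      rw [← ht0α, ← rpow_natCast, ← rpow_mul ht0p.le, ← rpow_add ht0p]; congr 1; push_cast; ring
    rw [e1, add_comm α 1] at h
    have h2 : Gamma (1+α) ≤ FS α x * Gamma (1-α) * x^2 := by
      rw [hrep0]
      generalize L0 α (cos (π*α)) t0 = L at h ⊢
      field_simp
      linarith
    have h3 : 1 ≤ FS α x * (c*x)^2 := by
      rw [← hc2] at h2
      by_contra hcon
      push Not at hcon
      nlinarith
    have hcx : 0 < c*x := by positivity
    have h4 : 0 < FS α x := by
      by_contra hcon
      push Not at hcon
      nlinarith [sq_nonneg (c*x)]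
    rw [inv_le_iff_one_le_mul₀ (by positivity)]
    nlinarith
  · set u := (c*x)⁻¹ with hu
    have hup : 0 < u := by positivity
    set p := u^(1/α) with hp
    have hpp : 0 < p := rpow_pos_of_pos hup _
    have hpα : p^α = u := by
      rw [hp, ← rpow_mul hup.le]; field_simp; simp
    set Q := (Gamma (1-α))⁻¹ * q with hQ
    obtain ⟨Ai, Av⟩ := A_int hα hpp
    have hle : ∀ r ∈ Ioi (0:ℝ), rexp (-(r*p)) * r^α * FS α (r^α)
        ≤ (FS α x - Q) * (rexp (-(r*p)) * r^α) + Q * x^2 * (rexp (-(r*p)) * r^(-α)) := by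
      intro r hr
      have hr : 0 < r := hr
      have h1 : FS α (r^α) ≤ FS α x + Q * ((t0/r)^(2*α) - 1) := by
        rw [FS_rep hα hr, hrep0, hQ]
        have := mul_le_mul_of_nonneg_left (hq r hr) (inv_pos.2 g1).le
        linarith
      have h2 : (t0/r)^(2*α) = x^2 * ((r^α)^2)⁻¹ := by
        rw [mul_comm 2 α, rpow_mul (by positivity), div_rpow ht0p.le hr.le, ht0α, rpow_two, div_pow]; rfl
      rw [h2] at h1
      rw [rpow_neg hr.le]
      have hra : 0 < r^α := rpow_pos_of_pos hr _
      have h3 := mul_le_mul_of_nonneg_left h1 (mul_pos (exp_pos (-(r*p))) hra).le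
      refine h3.trans (le_of_eq ?_)
      field_simp
      ring
    have i1 := lap_rpow_int (a := α) (by linarith) hpp
    have i2 := lap_rpow_int (a := -α) (by linarith) hpp
    have v1 := lap_rpow (a := α) (by linarith) hpp
    have v2 := lap_rpow (a := -α) (by linarith) hpp
    unfold Lap at v1 v2
    have hm := setIntegral_mono_on Ai ((i1.const_mul (FS α x - Q)).add (i2.const_mul (Q*x^2))) measurableSet_Ioi hle
    simp only [Pi.add_apply] at hm
    rw [integral_add (i1.const_mul (FS α x - Q)) (i2.const_mul (Q*x^2)), integral_const_mul, integral_const_mul, v1, v2, Av] at hm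
    have e1 : p^(-(α+1)) = p⁻¹ * u⁻¹ := by
      rw [rpow_neg hpp.le, rpow_add_one hpp.ne', hpα, mul_inv, mul_comm]
    have e2 : p^(-(-α+1)) = p⁻¹ * u := by
      rw [neg_add, neg_neg, ← sub_eq_add_neg, rpow_sub_one hpp.ne', hpα]; ring
    rw [e1, e2, hpα, add_comm α 1, neg_add_eq_sub, ← hc2] at hm
    have hxu : c * x * u = 1 := by rw [hu]; field_simp
    have h5 : Gamma (1+α) * p⁻¹ * u⁻¹ * (u^2/(1+u)^2) ≤ Gamma (1+α) * p⁻¹ * u⁻¹ * FS α x := by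
      have l : Gamma (1+α) * (p⁻¹ * u / (1+u)^2) = Gamma (1+α) * p⁻¹ * u⁻¹ * (u^2/(1+u)^2) := by field_simp
      have rr : (FS α x - Q) * (p⁻¹ * u⁻¹ * Gamma (1+α)) + Q * x^2 * (p⁻¹ * u * (c^2 * Gamma (1+α)))
          = Gamma (1+α) * p⁻¹ * u⁻¹ * (FS α x - Q + Q * (c*x*u)^2) := by field_simp
      rw [l, rr, hxu] at hm
      refine hm.trans (le_of_eq ?_)
      ring
    have h6 := le_of_mul_le_mul_left h5 (by positivity)
    refine le_trans (le_of_eq ?_) h6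
    rw [hu]
    field_simp
    ring

theorem FS_final (α x : ℝ) (hα : α ∈ Set.Ioo (0 : ℝ) 1) (hx : 0 ≤ x) :
    (1 + Real.sqrt (Real.Gamma (1 - α) / Real.Gamma (1 + α)) * x) ^ (-2 : ℝ) ≤ FS α x := by
  have h0 : 0 ≤ 1 + Real.sqrt (Real.Gamma (1 - α) / Real.Gamma (1 + α)) * x := by positivity
  rw [rpow_neg h0, rpow_two]
  rcases hx.eq_or_lt with h | h
  · subst h
    have : FS α 0 = 1 := by
      unfold FS
      rw [tsum_eq_single 0 (by intro n hn; simp [hn])]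
      simp [cS, (Gamma_pos_of_pos hα.1).ne']
    rw [this]; simp
  · exact FS_bound hα h

theorem kilbasSaigo_lower_bound_m_one (α x : ℝ)
    (hα : α ∈ Set.Ioo (0 : ℝ) 1) (hx : 0 ≤ x) :
    (1 + Real.sqrt (Real.Gamma (1 - α) / Real.Gamma (1 + α)) * x) ^ (-2 : ℝ) ≤
      kilbasSaigo α 1 (1 - 1 / α) (-x) := by
  have h := FS_final α x hα hx
  rw [← ks_eq hα.1 x] at h
  exact h
end

section
/- For every α ∈ (0,1) and x ≥ 0, one has (1 + √(Γ(1−α)/Γ(1+α)) x)^{−2} ≤ Γ(α) E_{α,α}(−x) ≤ (1 + (Γ(1+α)/Γ(1+2α)) x)^{−2}. -/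
/-- The two-parameter Mittag-Leffler function `E_{α,β}(x)` for real argument. -/
noncomputable def mittagLeffler (α β : ℝ) (x : ℝ) : ℝ :=
  ∑' n : ℕ, x ^ n / Real.Gamma (β + α * n)

open Filter Topology Polynomial

noncomputable def mlT (c : ℝ) (p : ℝ[X]) : ℝ[X] := p + C c * ((X ^ 2 - X) * derivative p)

noncomputable def mlP (α : ℝ) (q : ℝ[X]) (k : ℕ) : ℕ → ℝ[X]
  | 0 => q
  | m + 1 => mlT (α / (1 + α + k + m)) (mlP α q k m)

lemma mlT_comm (c d : ℝ) (p : ℝ[X]) : mlT c (mlT d p) = mlT d (mlT c p) := by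
  simp only [mlT, derivative_add, derivative_mul, derivative_C]
  ring

lemma mlP_comm (α d : ℝ) (q : ℝ[X]) (k m : ℕ) : mlT d (mlP α q k m) = mlP α (mlT d q) k m := by
  induction m with
  | zero => rfl
  | succ m ih => rw [mlP, mlP, mlT_comm, ih]

lemma mlP_shift (α : ℝ) (q : ℝ[X]) (k m : ℕ) :
    mlP α q k (m+1) = mlT (α / (1 + α + k)) (mlP α q (k+1) m) := by
  induction m with
  | zero => simp [mlP]
  | succ m ih =>
    rw [mlP, ih, mlP, mlT_comm]
    congr 2
    push_cast
    ring

def MlGood (m : ℕ) (p : ℝ[X]) : Prop := (∀ k, 0 ≤ p.coeff k) ∧ ∀ k, m < k → p.coeff k = 0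

lemma mlT_coeff_zero (c : ℝ) (p : ℝ[X]) : (mlT c p).coeff 0 = p.coeff 0 := by
  simp [mlT, coeff_zero_eq_eval_zero]

lemma mlT_coeff_succ (c : ℝ) (p : ℝ[X]) (k : ℕ) :
    (mlT c p).coeff (k+1) = (1 - c * (k+1)) * p.coeff (k+1) + c * k * p.coeff k := by
  have e : mlT c p = p + C c * (X * (X * derivative p)) - C c * (X * derivative p) := by
    rw [mlT]; ring
  rw [e, coeff_sub, coeff_add, coeff_C_mul, coeff_C_mul, coeff_X_mul, coeff_X_mul, coeff_derivative]
  rcases k with _ | k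
  · simp; ring
  · rw [coeff_X_mul, coeff_derivative]; push_cast; ring

lemma MlGood.T {m : ℕ} {p : ℝ[X]} (h : MlGood m p) {c : ℝ} (hc : 0 ≤ c) (hm : c * m ≤ 1) :
    MlGood (m+1) (mlT c p) := by
  constructor
  · intro k
    rcases k with _ | k
    · rw [mlT_coeff_zero]; exact h.1 0
    · rw [mlT_coeff_succ]
      have h1 := h.1 k
      have h2 := h.1 (k+1)
      have h3 : 0 ≤ (1 - c * (k+1)) * p.coeff (k+1) := by
        rcases le_or_gt (k+1) m with hk | hk
        · apply mul_nonneg _ h2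
          have : (k:ℝ) + 1 ≤ m := by exact_mod_cast hk
          nlinarith
        · rw [h.2 _ hk]; simp
      positivity
  · intro k hk
    rcases k with _ | k
    · omega
    · rw [mlT_coeff_succ, h.2 k (by omega), h.2 (k+1) (by omega)]; simp

lemma mlP_good {α : ℝ} (h0 : 0 < α) (h1 : α < 1) (j k m : ℕ)
    (hjk : α * j ≤ 1 + α + k) : MlGood (j+m) (mlP α (X^j) k m) := by
  induction m with
  | zero =>
    constructor
    · intro i; simp only [mlP, coeff_X_pow]; split_ifs <;> simp
    · intro i hi; simp only [mlP, coeff_X_pow]; rw [if_neg]; omega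
  | succ m ih =>
    rw [mlP]
    refine ih.T (by positivity) ?_
    rw [div_mul_eq_mul_div, div_le_one (by positivity)]
    push_cast
    have : (0:ℝ) ≤ m := by positivity
    nlinarith

lemma mlT_half : mlT (1/2) ((X:ℝ[X])^2) = X^3 := by
  have : (C (1/2) : ℝ[X]) * 2 = 1 := by
    rw [show (2:ℝ[X]) = C 2 from rfl, ← C_mul]; norm_num
  simp only [mlT, derivative_X_pow]
  have e2 : (C ((2:ℕ):ℝ) : ℝ[X]) = 2 := by simp; rfl
  rw [e2]
  simp only [show 2 - 1 = 1 from rfl, pow_one]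
  linear_combination (X^3 - X^2) * this

lemma MlGood.eval_mono {m : ℕ} {p : ℝ[X]} (h : MlGood m p) {v w : ℝ} (hv : 0 ≤ v) (hvw : v ≤ w) :
    p.eval v ≤ p.eval w := by
  rw [eval_eq_sum_range, eval_eq_sum_range]
  apply Finset.sum_le_sum
  intro i _
  have := h.1 i
  gcongr

lemma mlT_eval (c : ℝ) (p : ℝ[X]) (w : ℝ) :
    (mlT c p).eval w = p.eval w + c * ((w^2 - w) * p.derivative.eval w) := by
  simp [mlT]

lemma upper_step {m : ℕ} {p : ℝ[X]} (h : MlGood m p) {c y : ℝ} (hc : 0 ≤ c) (hy : 0 ≤ y) :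
    (mlT c p).eval (1 / (1 + y)) ≤ p.eval (1 / (1 + (1 + c) * y)) := by
  rw [mlT_eval, derivative_eval, eval_eq_sum_range, eval_eq_sum_range]
  rw [Polynomial.sum_over_range _ (by simp), Finset.mul_sum, Finset.mul_sum, ← Finset.sum_add_distrib]
  apply Finset.sum_le_sum
  intro i _
  have hp := h.1 i
  set w := 1 / (1 + y) with hw
  have hw0 : 0 < w := by positivity
  have hw1 : w ≤ 1 := by rw [hw, div_le_one (by positivity)]; linarith
  have e : 1 / (1 + (1 + c) * y) = w * (1 + c * (1 - w))⁻¹ := by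
    have : 1 - w = y / (1 + y) := by rw [hw]; field_simp; ring
    rw [this, hw]; field_simp; ring
  rw [e, mul_pow]
  have key : 1 - i * (c * (1-w)) ≤ ((1 + c * (1 - w))⁻¹)^i := by
    have hd : 0 ≤ c * (1-w) := mul_nonneg hc (by linarith)
    set d := c * (1-w)
    have b := one_add_mul_le_pow (a := (1+d)⁻¹ - 1) (by
      have : 0 < (1+d)⁻¹ := by positivity
      linarith) i
    have : -d ≤ (1+d)⁻¹ - 1 := by
      rw [← sub_nonneg]
      have : (1+d)⁻¹ - 1 - -d = d^2/(1+d) := by field_simp; ring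
      rw [this]; positivity
    have := mul_le_mul_of_nonneg_left this (Nat.cast_nonneg (α := ℝ) i)
    simp only [add_sub_cancel] at b
    linarith
  have : p.coeff i * w ^ i + c * ((w ^ 2 - w) * (p.coeff i * i * w ^ (i - 1)))
      = (p.coeff i * w^i) * (1 - i * (c * (1-w))) := by
    rcases i with _ | i
    · simp
    · simp only [Nat.add_sub_cancel]; ring
  rw [this, ← mul_assoc (p.coeff i)]
  apply mul_le_mul_of_nonneg_left key
  positivity

lemma lower_step {m : ℕ} {p : ℝ[X]} (h : MlGood m (mlT (1/2) p)) {c y : ℝ} (hc : 0 ≤ c)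
    (hc2 : 2 * c < 1) (hy : 0 ≤ y) :
    p.eval (1 / (1 + y / √(1 - 2 * c))) ≤ (mlT c p).eval (1 / (1 + y)) := by
  set γ := √(1 - 2 * c) with hγ
  have hγ0 : 0 < γ := Real.sqrt_pos.2 (by linarith)
  have hγ2 : γ^2 = 1 - 2 * c := Real.sq_sqrt (by linarith)
  have hγ1 : γ ≤ 1 := by nlinarith
  rcases hy.eq_or_lt with rfl | hy
  · simp [mlT_eval]
  set r : ℝ := (mlT (1/2) p).eval (1/(1+y)) with hr
  have hder : ∀ s : ℝ, 0 < s → HasDerivAt (fun s => s^2 * p.eval (1/(1+s)) - r * s^2)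
      (2 * s * ((mlT (1/2) p).eval (1/(1+s)) - r)) s := by
    intro s hs
    have h1 : HasDerivAt (fun s : ℝ => 1/(1+s)) (-(1/(1+s))^2) s := by
      have h := ((hasDerivAt_id' s).const_add 1).inv (by positivity)
      refine (h.congr_deriv ?_).congr_of_eventuallyEq (Eventually.of_forall fun t => ?_)
      · field_simp
      · simp
    have h2 := (p.hasDerivAt (1/(1+s))).comp s h1
    have h3 := (((hasDerivAt_id' s).pow 2).mul h2).sub (((hasDerivAt_id' s).pow 2).const_mul r)
    refine (h3.congr_deriv ?_).congr_of_eventuallyEq (Eventually.of_forall fun t => ?_)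
    · rw [mlT_eval]
      simp only [Function.comp, Pi.pow_apply]
      norm_num
      field_simp
      ring
    · simp
  have hanti : AntitoneOn (fun s => s^2 * p.eval (1/(1+s)) - r * s^2) (Set.Ici y) := by
    apply antitoneOn_of_deriv_nonpos (convex_Ici y)
    · intro s hs
      exact (hder s (hy.trans_le hs)).continuousAt.continuousWithinAt
    · intro s hs
      rw [interior_Ici] at hs
      exact (hder s (hy.trans hs)).differentiableAt.differentiableWithinAt
    · intro s hs
      rw [interior_Ici] at hs
      have hs' : y < s := hs
      rw [(hder s (hy.trans hs)).deriv]
      have : (mlT (1/2) p).eval (1/(1+s)) ≤ r := by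
        apply h.eval_mono (by have := hy.trans hs'; positivity)
        exact one_div_le_one_div_of_le (by positivity) (by linarith)
      have h5 := hy.trans hs'
      exact mul_nonpos_of_nonneg_of_nonpos (by positivity) (by linarith)
  have hle : y ≤ y / γ := by rw [le_div_iff₀ hγ0]; nlinarith
  have key := hanti (Set.mem_Ici.2 le_rfl) (Set.mem_Ici.2 hle) hle
  simp only at key
  have hT : (mlT c p).eval (1/(1+y)) = γ^2 * p.eval (1/(1+y)) + (1-γ^2) * r := by
    rw [hr, mlT_eval, mlT_eval, hγ2]; ring
  rw [hT]
  rw [div_pow] at key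
  have hy2 : 0 < y^2 / γ^2 := by positivity
  apply le_of_mul_le_mul_left _ hy2
  have : y^2/γ^2 * (γ^2 * p.eval (1/(1+y)) + (1-γ^2) * r) =
     y^2 * p.eval (1/(1+y)) - r * y^2 + r * (y^2/γ^2) := by field_simp; ring
  rw [this]; linarith

lemma upper_chain {α : ℝ} (h0 : 0 < α) (h1 : α < 1) (m k : ℕ) {y : ℝ} (hy : 0 ≤ y) :
    (mlP α (X^2) k m).eval (1/(1+y)) ≤
      (1 / (1 + (∏ i ∈ Finset.range m, (1 + α / (1 + α + k + i))) * y))^2 := by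
  induction m generalizing k y with
  | zero => simp [mlP]
  | succ m ih =>
    rw [mlP_shift]
    have hc : 0 ≤ α / (1 + α + k) := by positivity
    refine (upper_step (mlP_good h0 h1 2 (k+1) m (by push_cast; nlinarith [Nat.cast_nonneg (α := ℝ) k])) hc hy).trans ?_
    refine (ih (k+1) (by positivity)).trans (le_of_eq ?_)
    rw [Finset.prod_range_succ', ← mul_assoc]
    push_cast
    simp only [add_zero, add_assoc, add_comm (1:ℝ) (_ : ℝ)]

lemma lower_chain {α : ℝ} (h0 : 0 < α) (h1 : α < 1) (m k : ℕ) {y : ℝ} (hy : 0 ≤ y) :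
      (1 / (1 + y / √(∏ i ∈ Finset.range m, (1 - 2 * (α / (1 + α + k + i))))))^2 ≤
    (mlP α (X^2) k m).eval (1/(1+y)) := by
  induction m generalizing k y with
  | zero => simp [mlP]
  | succ m ih =>
    rw [mlP_shift]
    have hc : 0 ≤ α / (1 + α + k) := by positivity
    have hc2 : 2 * (α / (1 + α + k)) < 1 := by
      rw [← mul_div_assoc, div_lt_one (by positivity)]
      linarith [Nat.cast_nonneg (α := ℝ) k]
    have hg : MlGood (3+m) (mlT (1/2) (mlP α (X^2) (k+1) m)) := by
      rw [mlP_comm, mlT_half]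
      exact mlP_good h0 h1 3 (k+1) m (by push_cast; nlinarith [Nat.cast_nonneg (α := ℝ) k])
    refine le_trans ?_ (lower_step hg hc hc2 hy)
    refine le_trans (le_of_eq ?_) (ih (k+1) (by positivity))
    rw [Finset.prod_range_succ', Real.sqrt_mul' _ (by push_cast; rw [add_zero]; linarith), div_div, mul_comm (√_) (√_)]
    push_cast
    simp only [add_zero, add_assoc, add_comm (1:ℝ) (_ : ℝ)]

noncomputable def mlL (n : ℕ) (p : ℝ[X]) : ℝ := p.sum fun k a => a * (k.multichoose n : ℝ)

lemma mlL_add (n : ℕ) (p q : ℝ[X]) : mlL n (p + q) = mlL n p + mlL n q := by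
  unfold mlL
  exact Polynomial.sum_add_index _ _ _ (by simp) (by intros; ring)

lemma mlL_monomial (n k : ℕ) (a : ℝ) : mlL n (monomial k a) = a * (k.multichoose n : ℝ) := by
  unfold mlL
  exact Polynomial.sum_monomial_index _ _ (by simp)

lemma mlT_add (c : ℝ) (p q : ℝ[X]) : mlT c (p+q) = mlT c p + mlT c q := by
  simp only [mlT, derivative_add]; ring

lemma mlT_monomial (c : ℝ) (k : ℕ) (a : ℝ) :
    mlT c (monomial k a) = monomial k ((1 - c * k) * a) + monomial (k+1) (c * k * a) := by
  ext i
  rcases i with _ | i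
  · rw [mlT_coeff_zero]
    simp only [coeff_add, coeff_monomial]
    rcases k with _ | k <;> simp
  · rw [mlT_coeff_succ]
    simp only [coeff_add, coeff_monomial]
    by_cases h1 : k = i + 1
    · subst h1; simp
    · by_cases h2 : k = i
      · subst h2; simp
      · simp [h1, h2]

lemma multichoose_rel (k n : ℕ) : (k:ℝ) * ((k+1).multichoose n : ℝ) = (k + n) * (k.multichoose n : ℝ) := by
  rcases k with _ | k
  · rcases n with _ | n <;> simp
  · rw [Nat.multichoose_eq, Nat.multichoose_eq]
    have h := Nat.add_one_mul_choose_eq (k+n) k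
    have e1 : (k+1+1+n-1).choose n = (k+n+1).choose (k+1) := by
      rw [show k+1+1+n-1 = k+n+1 by omega, ← Nat.choose_symm_of_eq_add (by omega : k+n+1 = (k+1)+n)]
    have e2 : (k+1+n-1).choose n = (k+n).choose k := by
      rw [show k+1+n-1 = k+n by omega, ← Nat.choose_symm_of_eq_add (by omega : k+n = k+n)]
    rw [e1, e2]
    have h' : ((k+n+1 : ℕ) : ℝ) * ((k+n).choose k : ℝ) = ((k+n+1).choose (k+1) : ℝ) * ((k+1 : ℕ) : ℝ) := by
      exact_mod_cast h
    push_cast at h' ⊢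
    linarith

lemma mlL_T (n : ℕ) (c : ℝ) (p : ℝ[X]) : mlL n (mlT c p) = (1 + c * n) * mlL n p := by
  induction p using Polynomial.induction_on' with
  | add p q hp hq => rw [mlT_add, mlL_add, mlL_add, hp, hq]; ring
  | monomial k a =>
    rw [mlT_monomial, mlL_add, mlL_monomial, mlL_monomial, mlL_monomial]
    linear_combination c * a * multichoose_rel k n

lemma mlHasSum_congr {f g : ℕ → ℝ} {a : ℝ} (h : HasSum f a) (e : ∀ n, g n = f n) : HasSum g a := by
  rwa [funext e]

lemma mlL_hasSum (p : ℝ[X]) {z : ℝ} (hz : |z| < 1) :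
    HasSum (fun n => mlL n p * z^n) (p.eval (1/(1-z))) := by
  induction p using Polynomial.induction_on' with
  | add p q hp hq =>
    simp only [mlL_add, add_mul, eval_add]; exact hp.add hq
  | monomial k a =>
    simp only [mlL_monomial, eval_monomial, mul_assoc]
    apply HasSum.mul_left
    rcases k with _ | k
    · have := hasSum_ite_eq (0:ℕ) (1:ℝ)
      simp only [pow_zero]
      refine mlHasSum_congr this fun n => ?_
      rcases n with _ | n <;> simp
    · have := hasSum_choose_mul_geometric_of_norm_lt_one (𝕜 := ℝ) k (r := z) (by simpa using hz)
      rw [one_div_pow]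
      refine mlHasSum_congr this fun n => ?_
      rw [Nat.multichoose_eq, show k + 1 + n - 1 = n + k by omega, ← Nat.choose_symm_of_eq_add (by omega : n+k = k+n)]

lemma mlL_P (α : ℝ) (r m : ℕ) :
    mlL r (mlP α (X^2) 0 m) = (r + 1) * ∏ i ∈ Finset.range m, (1 + α / (1 + α + i) * r) := by
  induction m with
  | zero =>
    rw [mlP, X_pow_eq_monomial, mlL_monomial, Nat.multichoose_two]; simp
  | succ m ih =>
    rw [mlP, mlL_T, ih, Finset.prod_range_succ]; push_cast; rw [add_zero]; ring

lemma prod_lim {a b : ℝ} (ha : 0 < a) (hb : 0 < b) :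
    Tendsto (fun n : ℕ => (∏ i ∈ Finset.range (n+1), ((b + i) / (a + i))) * (n:ℝ) ^ (a - b)) atTop
      (𝓝 (Real.Gamma a / Real.Gamma b)) := by
  have h := (Real.GammaSeq_tendsto_Gamma a).div (Real.GammaSeq_tendsto_Gamma b)
    (Real.Gamma_pos_of_pos hb).ne'
  refine h.congr' ?_
  filter_upwards [eventually_ge_atTop 1] with n hn
  have hn' : (0:ℝ) < n := by exact_mod_cast hn
  rw [Pi.div_apply, Real.GammaSeq, Real.GammaSeq, Finset.prod_div_distrib, Real.rpow_sub hn']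
  have h1 : (0:ℝ) < ∏ i ∈ Finset.range (n+1), (a + i) := Finset.prod_pos fun i _ => by positivity
  have h2 : (0:ℝ) < ∏ i ∈ Finset.range (n+1), (b + i) := Finset.prod_pos fun i _ => by positivity
  have h3 : (0:ℝ) < (n:ℝ) ^ a := by positivity
  have h4 : (0:ℝ) < (n:ℝ) ^ b := by positivity
  have h5 : (0:ℝ) < (n.factorial : ℝ) := by positivity
  field_simp

/-- The terms. -/
noncomputable def mlU (α : ℝ) (n r : ℕ) : ℝ := mlL r (mlP α (X^2) 0 (n+1)) * ((n:ℝ) ^ (-α)) ^ r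

lemma mlU_nonneg {α : ℝ} (h0 : 0 < α) (n r : ℕ) : 0 ≤ mlU α n r := by
  rw [mlU, mlL_P]
  have : 0 ≤ ∏ i ∈ Finset.range (n+1), (1 + α / (1 + α + i) * r) :=
    Finset.prod_nonneg fun i _ => by positivity
  positivity

lemma mlU_lim {α : ℝ} (h0 : 0 < α) (r : ℕ) :
    Tendsto (fun n => mlU α n r) atTop (𝓝 (Real.Gamma α / Real.Gamma (α + α * r))) := by
  have h := (prod_lim (a := 1 + α) (b := 1 + α + α * r) (by positivity) (by positivity)).const_mul
    ((r:ℝ) + 1)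
  have e : ((r:ℝ) + 1) * (Real.Gamma (1 + α) / Real.Gamma (1 + α + α * r)) =
      Real.Gamma α / Real.Gamma (α + α * r) := by
    have g : 0 < Real.Gamma (α + α * r) := Real.Gamma_pos_of_pos (by positivity)
    rw [show 1 + α + α * r = (α + α * r) + 1 by ring, add_comm 1 α, Real.Gamma_add_one h0.ne',
      Real.Gamma_add_one (by positivity)]
    field_simp
    ring
  rw [e] at h
  refine h.congr fun n => ?_
  rw [mlU, mlL_P, ← Real.rpow_natCast, ← Real.rpow_mul (by positivity), mul_assoc]
  congr 2
  · apply Finset.prod_congr rfl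
    intro i _
    field_simp
    ring
  · congr 1; ring

lemma mlU_step {α : ℝ} (h0 : 0 < α) {n : ℕ} (hn : 1 ≤ n) (r : ℕ) : mlU α (n+1) r ≤ mlU α n r := by
  rw [mlU, mlU, mlL_P, mlL_P, Finset.prod_range_succ _ (n+1)]
  have hn' : (0:ℝ) < n := by exact_mod_cast hn
  have hP : 0 ≤ ∏ i ∈ Finset.range (n+1), (1 + α / (1 + α + i) * r) :=
    Finset.prod_nonneg fun i _ => by positivity
  set P := ∏ i ∈ Finset.range (n+1), (1 + α / (1 + α + i) * r)
  have key : (1 + α / (1 + α + ((n+1:ℕ):ℝ)) * r) * ((((n+1:ℕ):ℝ)) ^ (-α)) ^ r ≤ ((n:ℝ) ^ (-α)) ^ r := by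
    rw [← Real.rpow_natCast, ← Real.rpow_natCast, ← Real.rpow_mul (by positivity), ← Real.rpow_mul (by positivity)]
    have hs : 0 ≤ α * r := by positivity
    rw [neg_mul, Real.rpow_neg (by positivity), Real.rpow_neg (by positivity)]
    have e1 : 1 + α / (1 + α + ((n+1:ℕ):ℝ)) * r ≤ Real.exp ((α * r) / (n+1)) := by
      have h1 := Real.add_one_le_exp ((α * r) / (n+1))
      have h2 : α / (1 + α + ((n+1:ℕ):ℝ)) * r ≤ (α * r) / (n+1) := by
        rw [div_mul_eq_mul_div]
        apply div_le_div_of_nonneg_left hs (by positivity)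
        push_cast; linarith
      linarith
    have e2 : Real.exp ((α * r) / (n+1)) * (n:ℝ) ^ (α * r) ≤ ((n+1:ℕ):ℝ) ^ (α * r) := by
      rw [Real.rpow_def_of_pos hn', Real.rpow_def_of_pos (by positivity), ← Real.exp_add]
      apply Real.exp_le_exp.2
      have h3 := Real.one_sub_inv_le_log_of_pos (x := ((n:ℝ)+1)/n) (by positivity)
      rw [Real.log_div (by positivity) (by positivity)] at h3
      have h4 : 1 - (((n:ℝ)+1)/n)⁻¹ = 1/(n+1) := by field_simp; ring
      rw [h4] at h3
      have := mul_le_mul_of_nonneg_left h3 hs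
      push_cast
      rw [div_eq_mul_one_div]
      linarith
    have p1 : 0 < (n:ℝ) ^ (α * r) := by positivity
    have p2 : 0 < ((n+1:ℕ):ℝ) ^ (α * r) := by positivity
    rw [← div_eq_mul_inv, div_le_iff₀ p2, inv_mul_eq_div, le_div_iff₀ p1]
    exact (mul_le_mul_of_nonneg_right e1 p1.le).trans e2
  have := mul_le_mul_of_nonneg_left key (by positivity : 0 ≤ ((r:ℝ)+1) * P)
  linarith

lemma mlU_anti {α : ℝ} (h0 : 0 < α) {n m : ℕ} (hn : 1 ≤ n) (hm : n ≤ m) (r : ℕ) :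
    mlU α m r ≤ mlU α n r := by
  induction m, hm using Nat.le_induction with
  | base => rfl
  | succ m hm ih => exact (mlU_step h0 (hn.trans hm) r).trans ih

lemma ml_lim {α x : ℝ} (h0 : 0 < α) (hx : 0 ≤ x) :
    Tendsto (fun n : ℕ => (mlP α (X^2) 0 (n+1)).eval (1 / (1 + x * (n:ℝ)^(-α)))) atTop
      (𝓝 (Real.Gamma α * mittagLeffler α α (-x))) := by
  have ht : Tendsto (fun n : ℕ => x * (n:ℝ)^(-α)) atTop (𝓝 0) := by
    have := ((tendsto_rpow_neg_atTop h0).comp tendsto_natCast_atTop_atTop).const_mul x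
    simpa using this
  have hev : ∀ᶠ n : ℕ in atTop, x * (n:ℝ)^(-α) < 1 := ht.eventually (gt_mem_nhds one_pos)
  obtain ⟨n0, hn0⟩ := eventually_atTop.1 (hev.and (eventually_ge_atTop 1))
  have hsum : ∀ n ≥ n0, ∀ z : ℝ, |z| = x →
      HasSum (fun r => mlU α n r * z^r) ((mlP α (X^2) 0 (n+1)).eval (1 / (1 - z * (n:ℝ)^(-α)))) := by
    intro n hn z hz
    have hp : 0 ≤ (n:ℝ)^(-α) := by positivity
    have := mlL_hasSum (mlP α (X^2) 0 (n+1)) (z := z * (n:ℝ)^(-α)) (by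
      rw [abs_mul, hz, abs_of_nonneg hp]; exact (hn0 n hn).1)
    refine mlHasSum_congr this fun r => ?_
    rw [mlU, mul_pow]; ring
  have e : Real.Gamma α * mittagLeffler α α (-x) =
      ∑' r : ℕ, Real.Gamma α / Real.Gamma (α + α * r) * (-x)^r := by
    rw [mittagLeffler, ← tsum_mul_left]
    congr 1; ext r; ring
  rw [e]
  have key := tendsto_tsum_of_dominated_convergence (𝓕 := atTop)
    (f := fun n r => mlU α n r * (-x)^r) (g := fun r : ℕ => Real.Gamma α / Real.Gamma (α + α * r) * (-x)^r)
    (bound := fun r => mlU α n0 r * x^r) (hsum n0 le_rfl x (abs_of_nonneg hx)).summable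
    (fun r => (mlU_lim h0 r).mul_const _) (by
      filter_upwards [eventually_ge_atTop n0] with n hn r
      rw [norm_mul, norm_pow, norm_neg, Real.norm_of_nonneg (mlU_nonneg h0 n r), Real.norm_of_nonneg hx]
      exact mul_le_mul_of_nonneg_right (mlU_anti h0 (hn0 n0 le_rfl).2 hn r) (by positivity))
  refine key.congr' ?_
  filter_upwards [eventually_ge_atTop n0] with n hn
  rw [(hsum n hn (-x) (by rw [abs_neg, abs_of_nonneg hx])).tsum_eq]
  congr 3; ring

theorem mittagLeffler_alpha_alpha_bounds (α x : ℝ)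
    (hα : α ∈ Set.Ioo (0 : ℝ) 1) (hx : 0 ≤ x) :
    (1 + Real.sqrt (Real.Gamma (1 - α) / Real.Gamma (1 + α)) * x) ^ (-2 : ℝ) ≤
      Real.Gamma α * mittagLeffler α α (-x) ∧
    Real.Gamma α * mittagLeffler α α (-x) ≤
      (1 + Real.Gamma (1 + α) / Real.Gamma (1 + 2 * α) * x) ^ (-2 : ℝ) := by
  obtain ⟨h0, h1⟩ := hα
  have g1 : 0 < Real.Gamma (1 - α) := Real.Gamma_pos_of_pos (by linarith)
  have g2 : 0 < Real.Gamma (1 + α) := Real.Gamma_pos_of_pos (by linarith)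
  have g3 : 0 < Real.Gamma (1 + 2 * α) := Real.Gamma_pos_of_pos (by linarith)
  have conv : ∀ t : ℝ, 0 ≤ t → t ^ (-2 : ℝ) = (1 / t) ^ 2 := by
    intro t ht
    rw [Real.rpow_neg ht, one_div, inv_pow]
    congr 1
    exact_mod_cast Real.rpow_natCast t 2
  have hlim := ml_lim h0 hx
  constructor
  · rw [conv _ (by positivity)]
    have hp := prod_lim (a := 1 + α) (b := 1 - α) (by linarith) (by linarith)
    have hq := hp.sqrt
    have hs : Tendsto (fun n : ℕ => x / √((∏ i ∈ Finset.range (n+1), ((1 - α + i) / (1 + α + i))) *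
        (n:ℝ) ^ ((1 + α) - (1 - α)))) atTop (𝓝 (√(Real.Gamma (1 - α) / Real.Gamma (1 + α)) * x)) := by
      have := (tendsto_const_nhds (x := x)).div hq (Real.sqrt_pos.2 (by positivity)).ne'
      rw [← inv_div (Real.Gamma (1-α)), Real.sqrt_inv, div_inv_eq_mul, mul_comm x] at this
      exact this
    have hs2 := ((tendsto_const_nhds (x := (1:ℝ))).div (hs.const_add 1) (by positivity)).pow 2
    refine le_of_tendsto_of_tendsto hs2 hlim ?_
    filter_upwards [eventually_ge_atTop 1] with n hn
    have hn' : (0:ℝ) < n := by exact_mod_cast hn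
    refine le_trans (le_of_eq ?_) (lower_chain h0 h1 (n+1) 0 (y := x * (n:ℝ)^(-α)) (by positivity))
    have ep : ∏ i ∈ Finset.range (n+1), (1 - 2 * (α / (1 + α + ((0:ℕ):ℝ) + i))) =
        ∏ i ∈ Finset.range (n+1), ((1 - α + i) / (1 + α + i)) := by
      apply Finset.prod_congr rfl
      intro i _
      push_cast
      rw [add_zero]
      field_simp
      ring
    rw [ep]
    simp only [Pi.div_apply]
    rw [Real.sqrt_mul' _ (by positivity)]
    have e2 : √((n:ℝ) ^ ((1 + α) - (1 - α))) = (n:ℝ)^α := by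
      rw [show (1 + α) - (1 - α) = α + α by ring, Real.rpow_add hn']
      exact Real.sqrt_mul_self (by positivity)
    rw [e2, Real.rpow_neg hn'.le, ← div_eq_mul_inv, div_div, mul_comm (√_)]
  · rw [conv _ (by positivity)]
    have hp := prod_lim (a := 1 + α) (b := 1 + 2 * α) (by linarith) (by linarith)
    have hs2 := ((tendsto_const_nhds (x := (1:ℝ))).div ((hp.mul_const x).const_add 1) (by positivity)).pow 2
    refine le_of_tendsto_of_tendsto hlim hs2 ?_
    filter_upwards [eventually_ge_atTop 1] with n hn
    have hn' : (0:ℝ) < n := by exact_mod_cast hn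
    refine le_trans (upper_chain h0 h1 (n+1) 0 (y := x * (n:ℝ)^(-α)) (by positivity)) (le_of_eq ?_)
    have ep : ∏ i ∈ Finset.range (n+1), (1 + α / (1 + α + ((0:ℕ):ℝ) + i)) =
        ∏ i ∈ Finset.range (n+1), ((1 + 2 * α + i) / (1 + α + i)) := by
      apply Finset.prod_congr rfl
      intro i _
      push_cast
      rw [add_zero]
      field_simp
      ring
    rw [ep, show (1 + α) - (1 + 2 * α) = -α by ring]
    congr 3; ring
end

section
/- For every α ∈ (0,1], β > α and x ≥ 0, one has 1/(1 + (Γ(β−α)/Γ(β)) x) ≤ Γ(β) E_{α,β}(−x) ≤ 1/(1 + (Γ(β)/Γ(β+α)) x). -/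
open Set Filter Topology MeasureTheory

theorem ml_hasSum_congr {f g : ℕ → ℝ} {A B : ℝ} (h : ∀ n, f n = g n) (hAB : A = B)
    (hf : HasSum f A) : HasSum g B := by
  rw [← funext h, ← hAB]; exact hf

theorem ml_gamma_ratio {x a : ℝ} (hx : 1 < x) (ha : 0 < a) :
    Real.Gamma x * (x - 1) ^ a ≤ Real.Gamma (x + a) := by
  have h0 : 0 < x - 1 := by linarith
  have hc := Real.convexOn_log_Gamma.slope_mono_adjacent (x := x - 1) (y := x) (z := x + a)
    h0 (by simp only [mem_Ioi]; linarith) (by linarith) (by linarith)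
  have hG := Real.Gamma_pos_of_pos h0
  have hG1 := Real.Gamma_pos_of_pos (show 0 < x by linarith)
  have hG2 := Real.Gamma_pos_of_pos (show 0 < x + a by linarith)
  have e : Real.Gamma x = (x - 1) * Real.Gamma (x - 1) := by
    have := Real.Gamma_add_one h0.ne'
    simpa using this
  have e2 : Real.log (Real.Gamma x) = Real.log (x - 1) + Real.log (Real.Gamma (x - 1)) := by
    rw [e, Real.log_mul h0.ne' hG.ne']
  simp only [Function.comp] at hc
  rw [e2] at hc
  have h3 : a * Real.log (x - 1) ≤ Real.log (Real.Gamma (x + a)) - Real.log (Real.Gamma x) := by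
    rw [e2]
    have : x + a - x = a := by ring
    rw [this, le_div_iff₀ ha] at hc
    have : x - (x - 1) = 1 := by ring
    rw [this] at hc
    linarith
  rw [← Real.log_le_log_iff (by positivity) hG2, Real.log_mul hG1.ne' (by positivity),
    Real.log_rpow h0]
  linarith

theorem ml_summable {a b : ℝ} (ha : 0 < a) (hb : 0 < b) (x : ℝ) :
    Summable fun n : ℕ => x ^ n / Real.Gamma (b + a * n) := by
  have hpos : ∀ n : ℕ, 0 < b + a * n := fun n => by positivity
  have ht : Tendsto (fun n : ℕ => b + a * n - 1) atTop atTop := by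
    apply tendsto_atTop_add_const_right
    apply tendsto_atTop_add_const_left
    exact tendsto_natCast_atTop_atTop.const_mul_atTop ha
  have ht2 := (tendsto_rpow_atTop ha).comp ht
  apply summable_of_ratio_norm_eventually_le (r := 1/2) (by norm_num)
  filter_upwards [ht.eventually_gt_atTop 0, ht2.eventually_ge_atTop (2 * |x|)] with n h1 h2
  have hr := ml_gamma_ratio (x := b + a * n) (by linarith) ha
  have hG := Real.Gamma_pos_of_pos (hpos n)
  have hG1 := Real.Gamma_pos_of_pos (hpos (n+1))
  simp only [Function.comp] at h2
  rw [norm_div, norm_div, norm_pow, norm_pow, Real.norm_of_nonneg hG.le,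
    Real.norm_of_nonneg hG1.le, Real.norm_eq_abs]
  have e : b + a * ((n + 1 : ℕ) : ℝ) = b + a * n + a := by push_cast; ring
  rw [e] at hG1 ⊢
  rw [← mul_div_assoc, div_le_div_iff₀ hG1 hG, pow_succ]
  have hx0 : 0 ≤ |x| ^ n := by positivity
  have : |x| * Real.Gamma (b + a * n) ≤ 1/2 * Real.Gamma (b + a * n + a) := by nlinarith
  nlinarith

theorem ml_continuous {a b : ℝ} (ha : 0 < a) (hb : 0 < b) : Continuous (mittagLeffler a b) := by
  rw [continuous_iff_continuousAt]
  intro x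
  have hpos : ∀ n : ℕ, 0 < Real.Gamma (b + a * n) := fun n => Real.Gamma_pos_of_pos (by positivity)
  have : ContinuousOn (mittagLeffler a b) (Icc (-(|x|+1)) (|x|+1)) := by
    unfold mittagLeffler
    apply continuousOn_tsum (u := fun n : ℕ => (|x|+1) ^ n / Real.Gamma (b + a * n))
    · intro n; fun_prop
    · exact ml_summable ha hb _
    · intro n y hy
      rw [norm_div, norm_pow, Real.norm_of_nonneg (hpos n).le, Real.norm_eq_abs]
      gcongr
      exact abs_le.mpr hy
  apply this.continuousAt
  apply Icc_mem_nhds <;> linarith [neg_abs_le x, le_abs_self x]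

theorem ml_zero (a b : ℝ) : mittagLeffler a b 0 = 1 / Real.Gamma b := by
  unfold mittagLeffler
  rw [tsum_eq_single 0]
  · simp
  · intro n hn; simp [hn]

theorem ml_step {a b : ℝ} (ha : 0 < a) (hb : 0 < b) (x : ℝ) :
    mittagLeffler a b x = 1 / Real.Gamma b + x * mittagLeffler a (b + a) x := by
  unfold mittagLeffler
  rw [(ml_summable ha hb x).tsum_eq_zero_add, ← tsum_mul_left]
  congr 1
  · simp
  · apply tsum_congr; intro n
    have : b + a * ((n + 1 : ℕ) : ℝ) = b + a + a * n := by push_cast; ring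
    rw [this, pow_succ]; ring

theorem ml_beta {p q : ℝ} (hp : 0 < p) (hq : 0 < q) :
    IntervalIntegrable (fun s : ℝ => s ^ (p - 1) * (1 - s) ^ (q - 1)) volume 0 1 ∧
    ∫ s in (0:ℝ)..1, s ^ (p - 1) * (1 - s) ^ (q - 1) =
      Real.Gamma p * Real.Gamma q / Real.Gamma (p + q) := by
  have hc := Complex.betaIntegral_convergent (u := p) (v := q) (by simpa) (by simpa)
  have key : ∀ s ∈ Icc (0:ℝ) 1, ((s:ℂ) ^ ((p:ℂ) - 1) * (1 - (s:ℂ)) ^ ((q:ℂ) - 1)) =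
      ((s ^ (p - 1) * (1 - s) ^ (q - 1) : ℝ) : ℂ) := by
    intro s hs
    push_cast
    rw [Complex.ofReal_cpow hs.1, Complex.ofReal_cpow (by linarith [hs.2])]
    push_cast; rfl
  constructor
  · have := hc.congr (g := fun s : ℝ => ((s ^ (p - 1) * (1 - s) ^ (q - 1) : ℝ) : ℂ)) (by
      intro s hs
      rw [uIoc_of_le zero_le_one] at hs
      exact key s ⟨hs.1.le, hs.2⟩)
    rw [intervalIntegrable_iff] at this ⊢
    have h2 := this.re
    simp only [RCLike.re_eq_complex_re, Complex.ofReal_re] at h2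
    exact h2
  · have h1 : Complex.betaIntegral p q = ((∫ s in (0:ℝ)..1, s ^ (p - 1) * (1 - s) ^ (q - 1) : ℝ) : ℂ) := by
      rw [Complex.betaIntegral, ← intervalIntegral.integral_ofReal]
      apply intervalIntegral.integral_congr
      intro s hs
      rw [uIcc_of_le zero_le_one] at hs
      exact key s hs
    have h2 := ProbabilityTheory.beta_eq_betaIntegralReal p q hp hq
    rw [h1, Complex.ofReal_re] at h2
    rw [← h2]; rfl

theorem ml_swap {a b q : ℝ} (ha : 0 < a) (hb : 0 < b) (hq : 0 < q) (y : ℝ) {φ : ℝ → ℝ}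
    (hφ : ContinuousOn φ (Icc 0 1)) :
    HasSum (fun n : ℕ => (-y) ^ n / Real.Gamma (b + a * n) *
        ∫ s in (0:ℝ)..1, s ^ (b + a * n - 1) * (1 - s) ^ (q - 1) * φ s)
      (∫ s in (0:ℝ)..1, s ^ (b - 1) * (1 - s) ^ (q - 1) * φ s * mittagLeffler a b (-y * s ^ a)) := by
  have hpos : ∀ n : ℕ, 0 < Real.Gamma (b + a * n) := fun n => Real.Gamma_pos_of_pos (by positivity)
  obtain ⟨C, hC⟩ := isCompact_Icc.exists_bound_of_continuousOn hφ
  have hφ' : ContinuousOn φ (uIcc 0 1) := by rwa [uIcc_of_le zero_le_one]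
  have hI : ∀ n : ℕ, IntervalIntegrable (fun s : ℝ => s ^ (b + a * n - 1) * (1 - s) ^ (q - 1) * φ s)
      volume 0 1 := fun n => (ml_beta (by positivity) hq).1.mul_continuousOn hφ'
  have hJ := (ml_beta hb hq).1
  rw [intervalIntegrable_iff, uIoc_of_le zero_le_one] at hJ
  have H := hasSum_integral_of_summable_integral_norm (μ := volume.restrict (Ioc (0:ℝ) 1))
    (F := fun (n : ℕ) s => (-y) ^ n / Real.Gamma (b + a * n) *
        (s ^ (b + a * n - 1) * (1 - s) ^ (q - 1) * φ s)) ?_ ?_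
  · refine ml_hasSum_congr (fun n => ?_) ?_ H
    · rw [intervalIntegral.integral_of_le zero_le_one, integral_const_mul]
    · rw [intervalIntegral.integral_of_le zero_le_one]
      apply setIntegral_congr_fun measurableSet_Ioc
      intro s hs
      symm
      simp only [mittagLeffler]
      rw [← tsum_mul_left]
      apply tsum_congr; intro n
      have : s ^ (b + a * n - 1) = s ^ (b - 1) * (s ^ a) ^ n := by
        rw [← Real.rpow_natCast, ← Real.rpow_mul hs.1.le, ← Real.rpow_add hs.1]
        congr 1; ring
      rw [this, mul_pow]; ring
  · intro n
    have := hI n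
    rw [intervalIntegrable_iff, uIoc_of_le zero_le_one] at this
    exact this.const_mul _
  · apply Summable.of_nonneg_of_le (f := fun n : ℕ => |y| ^ n / Real.Gamma (b + a * n) *
      ∫ s in Ioc (0:ℝ) 1, s ^ (b - 1) * (1 - s) ^ (q - 1) * C)
    · intro n; positivity
    · intro n
      rw [← integral_const_mul]
      have := hI n
      rw [intervalIntegrable_iff, uIoc_of_le zero_le_one] at this
      apply setIntegral_mono_on (this.const_mul _).norm ((hJ.mul_const _).const_mul _)
        measurableSet_Ioc
      intro s hs
      have h1 : 0 ≤ 1 - s := by linarith [hs.2]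
      have h0 := hs.1
      rw [norm_mul, norm_div, norm_pow, norm_neg, Real.norm_of_nonneg (hpos n).le, Real.norm_eq_abs,
        norm_mul, Real.norm_of_nonneg (by positivity : 0 ≤ s ^ (b + a * n - 1) * (1 - s) ^ (q - 1))]
      have := hpos n
      have h2 : s ^ (b + a * n - 1) ≤ s ^ (b - 1) :=
        Real.rpow_le_rpow_of_exponent_ge hs.1 hs.2 (by nlinarith [mul_nonneg ha.le n.cast_nonneg])
      have := hC s ⟨hs.1.le, hs.2⟩
      gcongr
    · exact (ml_summable ha hb _).mul_right _

theorem ml_int {a b q : ℝ} (ha : 0 < a) (hb : 0 < b) (hq : 0 < q) (y : ℝ) :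
    ∫ s in (0:ℝ)..1, s ^ (b - 1) * (1 - s) ^ (q - 1) * mittagLeffler a b (-y * s ^ a)
      = Real.Gamma q * mittagLeffler a (b + q) (-y) := by
  have h := ml_swap ha hb hq y (φ := fun _ => 1) continuousOn_const
  simp only [mul_one] at h
  rw [← h.tsum_eq, mittagLeffler, ← tsum_mul_left]
  apply tsum_congr; intro n
  have hpos := Real.Gamma_pos_of_pos (show 0 < b + a * n by positivity)
  rw [(ml_beta (show 0 < b + a * n by positivity) hq).2,
    show b + a * n + q = b + q + a * n by ring]
  field_simp

theorem ml_cont_pow {a b c : ℝ} (ha : 0 < a) (hb : 0 < b) :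
    Continuous (fun s : ℝ => mittagLeffler a b (c * s ^ a)) := by
  apply (ml_continuous ha hb).comp
  exact continuous_const.mul (Real.continuous_rpow_const ha.le)

theorem ml_intble {a b p q c : ℝ} (ha : 0 < a) (hb : 0 < b) (hp : 0 < p) (hq : 0 < q) :
    IntervalIntegrable (fun s : ℝ => s ^ (p - 1) * (1 - s) ^ (q - 1) * mittagLeffler a b (c * s ^ a))
      volume 0 1 :=
  (ml_beta hp hq).1.mul_continuousOn (ml_cont_pow ha hb).continuousOn

theorem ml_volterra {a t : ℝ} (ha : 0 < a) (ht : 0 < t) :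
    IntervalIntegrable (fun s : ℝ => (t - s) ^ (a - 1) *
      (s ^ (a - 1) * mittagLeffler a a (-s ^ a))) volume 0 t ∧
    Real.Gamma a * (t ^ (a - 1) * mittagLeffler a a (-t ^ a)) = t ^ (a - 1) -
      ∫ s in (0:ℝ)..t, (t - s) ^ (a - 1) * (s ^ (a - 1) * mittagLeffler a a (-s ^ a)) := by
  have hG := Real.Gamma_pos_of_pos ha
  have h1 := ml_intble (c := -t ^ a) ha ha ha ha
  have h2 := ml_int ha ha ha (t ^ a)
  set F : ℝ → ℝ := fun s => (t - s) ^ (a - 1) * (s ^ (a - 1) * mittagLeffler a a (-s ^ a)) with hF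
  have key : ∀ s ∈ Icc (0:ℝ) 1, F (t * s) = (t ^ (a - 1) * t ^ (a - 1)) *
      (s ^ (a - 1) * (1 - s) ^ (a - 1) * mittagLeffler a a (-t ^ a * s ^ a)) := by
    intro s hs
    simp only [hF]
    rw [show t - t * s = t * (1 - s) by ring, Real.mul_rpow ht.le (by linarith [hs.2]),
      Real.mul_rpow ht.le hs.1, Real.mul_rpow ht.le hs.1, neg_mul]
    ring
  constructor
  · have h3 : IntervalIntegrable (fun s => F (t * s)) volume 0 1 := by
      apply (h1.const_mul (t ^ (a - 1) * t ^ (a - 1))).congr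
      intro s hs
      rw [uIoc_of_le zero_le_one] at hs
      exact (key s ⟨hs.1.le, hs.2⟩).symm
    have h4 := h3.comp_mul_left (c := t⁻¹)
    simpa [← mul_assoc, ht.ne'] using h4
  · have h3 := intervalIntegral.integral_comp_mul_left (a := 0) (b := 1) F ht.ne'
    have h4 : ∫ s in (0:ℝ)..1, F (t * s) = (t ^ (a - 1) * t ^ (a - 1)) *
        (Real.Gamma a * mittagLeffler a (a + a) (-t ^ a)) := by
      rw [← h2, ← intervalIntegral.integral_const_mul]
      apply intervalIntegral.integral_congr
      intro s hs
      rw [uIcc_of_le zero_le_one] at hs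
      exact key s hs
    rw [h4] at h3
    simp only [mul_zero, mul_one, smul_eq_mul] at h3
    have h5 : ∫ s in (0:ℝ)..t, F s = t * ((t ^ (a - 1) * t ^ (a - 1)) *
        (Real.Gamma a * mittagLeffler a (a + a) (-t ^ a))) := by
      rw [h3]; field_simp
    rw [h5, ml_step ha ha]
    have h6 : t ^ a = t * t ^ (a - 1) := by
      rw [Real.rpow_sub_one ht.ne']; field_simp
    generalize mittagLeffler a (a + a) (-t ^ a) = M
    rw [h6]; field_simp; ring

theorem ml_pos_aux {a : ℝ} (ha : 0 < a) (ha1 : a ≤ 1) {t : ℝ} (ht : 0 ≤ t) :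
    0 < mittagLeffler a a (-t ^ a) := by
  have hG := Real.Gamma_pos_of_pos ha
  set h : ℝ → ℝ := fun s => mittagLeffler a a (-s ^ a) with hh
  have hcont : Continuous h := by
    have := ml_cont_pow (c := -1) ha ha
    simpa only [neg_one_mul] using this
  by_contra hneg
  set S : Set ℝ := Ici 0 ∩ h ⁻¹' Iic 0 with hS
  have hScl : IsClosed S := isClosed_Ici.inter (isClosed_Iic.preimage hcont)
  have hSne : S.Nonempty := ⟨t, ht, not_lt.mp hneg⟩
  have hSbd : BddBelow S := ⟨0, fun x hx => hx.1⟩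
  set t0 := sInf S with ht0
  have ht0S : t0 ∈ S := hScl.csInf_mem hSne hSbd
  have hlt : ∀ s, 0 ≤ s → s < t0 → 0 < h s := by
    intro s hs hst
    by_contra hc
    exact absurd (csInf_le hSbd (show s ∈ S from ⟨hs, not_lt.mp hc⟩)) (not_le.mpr hst)
  have h0 : 0 < h 0 := by
    simp only [hh, Real.zero_rpow ha.ne', neg_zero, ml_zero]; positivity
  have ht0pos : 0 < t0 := by
    rcases (show (0:ℝ) ≤ t0 from ht0S.1).eq_or_lt with h | h
    · have := ht0S.2
      rw [← h] at this
      exact absurd h0 (not_lt.mpr this)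
    · exact h
  have ht0le : h t0 ≤ 0 := ht0S.2
  -- choose the step
  obtain ⟨δ, hδ, hδ1, hδ2⟩ : ∃ δ : ℝ, 0 < δ ∧ δ ≤ t0 / 2 ∧ δ ^ a / a < Real.Gamma a / 2 := by
    have hc : Tendsto (fun d : ℝ => d ^ a / a) (𝓝[>] 0) (𝓝 0) := by
      have : Continuous (fun d : ℝ => d ^ a / a) := (Real.continuous_rpow_const ha.le).div_const a
      have := this.tendsto 0
      simp only [Real.zero_rpow ha.ne', zero_div] at this
      exact this.mono_left nhdsWithin_le_nhds
    have e1 := hc.eventually_lt_const (show 0 < Real.Gamma a / 2 by positivity)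
    have e2 : ∀ᶠ d : ℝ in 𝓝[>] 0, d ∈ Ioc 0 (t0/2) := Ioc_mem_nhdsGT (by positivity)
    obtain ⟨d, h1, h2⟩ := (e1.and e2).exists
    exact ⟨d, h2.1, h2.2, h1⟩
  set u : ℝ → ℝ := fun s => s ^ (a - 1) * h s with hu
  have hucont : ContinuousOn u (Icc (t0 - δ) t0) := by
    apply ContinuousOn.mul _ hcont.continuousOn
    apply ContinuousOn.rpow_const continuousOn_id
    intro x hx; left; simp only [id]; linarith [hx.1]
  obtain ⟨t1, ht1, hmax⟩ := isCompact_Icc.exists_isMaxOn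
    (nonempty_Icc.mpr (show t0 - δ ≤ t0 by linarith)) hucont
  have hupos : ∀ s, 0 < s → s < t0 → 0 < u s := fun s h1 h2 =>
    mul_pos (Real.rpow_pos_of_pos h1 _) (hlt s h1.le h2)
  have hut1 : 0 < u t1 := lt_of_lt_of_le (hupos (t0 - δ) (by linarith) (by linarith))
    (hmax ⟨le_rfl, by linarith⟩)
  have hut0 : u t0 ≤ 0 := mul_nonpos_of_nonneg_of_nonpos (by positivity) ht0le
  have ht1lt : t1 < t0 := by
    rcases ht1.2.eq_or_lt with h | h
    · rw [h] at hut1; linarith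
    · exact h
  have ht1pos : 0 < t1 := by linarith [ht1.1]
  obtain ⟨i0, v0⟩ := ml_volterra ha ht0pos
  obtain ⟨i1, v1⟩ := ml_volterra ha ht1pos
  change Real.Gamma a * u t0 = t0 ^ (a - 1) - ∫ s in (0:ℝ)..t0, (t0 - s) ^ (a - 1) * u s at v0
  change Real.Gamma a * u t1 = t1 ^ (a - 1) - ∫ s in (0:ℝ)..t1, (t1 - s) ^ (a - 1) * u s at v1
  change IntervalIntegrable (fun s => (t0 - s) ^ (a - 1) * u s) volume 0 t0 at i0
  change IntervalIntegrable (fun s => (t1 - s) ^ (a - 1) * u s) volume 0 t1 at i1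
  have i01 : IntervalIntegrable (fun s => (t0 - s) ^ (a - 1) * u s) volume 0 t1 :=
    i0.mono_set (by rw [uIcc_of_le ht1pos.le, uIcc_of_le ht0pos.le]; exact Icc_subset_Icc_right ht1lt.le)
  have i02 : IntervalIntegrable (fun s => (t0 - s) ^ (a - 1) * u s) volume t1 t0 :=
    i0.mono_set (by rw [uIcc_of_le ht1lt.le, uIcc_of_le ht0pos.le]; exact Icc_subset_Icc_left ht1pos.le)
  rw [← intervalIntegral.integral_add_adjacent_intervals i01 i02] at v0
  set r := t0 / t1 with hr
  have hrpos : 0 < r := by positivity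
  have A : ∫ s in (0:ℝ)..t1, (t0 - s) ^ (a - 1) * u s ≤
      r ^ (a - 1) * ∫ s in (0:ℝ)..t1, (t1 - s) ^ (a - 1) * u s := by
    rw [← intervalIntegral.integral_const_mul]
    apply intervalIntegral.integral_mono_on_of_le_Ioo ht1pos.le i01 (i1.const_mul _)
    intro s hs
    rw [← mul_assoc (r ^ (a - 1)), ← Real.mul_rpow hrpos.le (by linarith [hs.2])]
    apply mul_le_mul_of_nonneg_right _ (hupos s hs.1 (by linarith [hs.2])).le
    apply Real.rpow_le_rpow_of_nonpos _ _ (by linarith)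
    · have : 0 < t1 - s := by linarith [hs.2]
      positivity
    · rw [hr, div_mul_eq_mul_div, div_le_iff₀ ht1pos]
      nlinarith [hs.1]
  have i3 : IntervalIntegrable (fun s => (t0 - s) ^ (a - 1)) volume t1 t0 := by
    have := (intervalIntegral.intervalIntegrable_rpow' (a := t0 - t1) (b := 0) (r := a - 1)
      (by linarith)).comp_sub_left t0
    simpa using this
  have B : ∫ s in t1..t0, (t0 - s) ^ (a - 1) * u s ≤ (t0 - t1) ^ a / a * u t1 := by
    have e : ∫ s in t1..t0, (t0 - s) ^ (a - 1) = (t0 - t1) ^ a / a := by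
      rw [intervalIntegral.integral_comp_sub_left (fun s => s ^ (a - 1)) t0,
        integral_rpow (Or.inl (by linarith))]
      simp [Real.zero_rpow ha.ne']
    rw [← e, ← intervalIntegral.integral_mul_const]
    apply intervalIntegral.integral_mono_on ht1lt.le i02 (i3.mul_const _)
    intro s hs
    apply mul_le_mul_of_nonneg_left (hmax ⟨by linarith [ht1.1, hs.1], hs.2⟩)
    exact Real.rpow_nonneg (by linarith [hs.2]) _
  have C : (t0 - t1) ^ a / a ≤ δ ^ a / a := by
    have : t0 - t1 ≤ δ := by linarith [ht1.1]
    have : 0 ≤ t0 - t1 := by linarith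
    gcongr
  have D : r ^ (a - 1) * t1 ^ (a - 1) = t0 ^ (a - 1) := by
    rw [← Real.mul_rpow hrpos.le ht1pos.le, hr, div_mul_cancel₀ _ ht1pos.ne']
  have R : 1 / 2 ≤ r ^ (a - 1) := by
    have h2 : r ≤ 2 := by
      rw [hr, div_le_iff₀ ht1pos]; linarith [ht1.1]
    calc (1:ℝ) / 2 = 2 ^ (-1 : ℝ) := by rw [Real.rpow_neg_one]; norm_num
      _ ≤ 2 ^ (a - 1) := Real.rpow_le_rpow_of_exponent_le (by norm_num) (by linarith)
      _ ≤ r ^ (a - 1) := Real.rpow_le_rpow_of_nonpos hrpos h2 (by linarith)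
  have e1 : ∫ s in (0:ℝ)..t1, (t1 - s) ^ (a - 1) * u s = t1 ^ (a - 1) - Real.Gamma a * u t1 := by
    linarith
  rw [e1, mul_sub, D] at A
  have F1 : r ^ (a - 1) * (Real.Gamma a * u t1) ≤ δ ^ a / a * u t1 := by
    have := mul_le_mul_of_nonneg_right C hut1.le
    have := mul_nonpos_of_nonneg_of_nonpos hG.le hut0
    linarith
  have F2 : 1 / 2 * (Real.Gamma a * u t1) ≤ r ^ (a - 1) * (Real.Gamma a * u t1) :=
    mul_le_mul_of_nonneg_right R (by positivity)
  have F3 : δ ^ a / a * u t1 < Real.Gamma a / 2 * u t1 := mul_lt_mul_of_pos_right hδ2 hut1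
  linarith

theorem ml_pos {a : ℝ} (ha : 0 < a) (ha1 : a ≤ 1) {x : ℝ} (hx : 0 ≤ x) :
    0 < mittagLeffler a a (-x) := by
  have := ml_pos_aux ha ha1 (Real.rpow_nonneg hx a⁻¹)
  rwa [Real.rpow_inv_rpow hx ha.ne'] at this

theorem ml_anti {a : ℝ} (ha : 0 < a) (ha1 : a ≤ 1) {x y : ℝ} (hx : 0 ≤ x) (hxy : x ≤ y) :
    mittagLeffler a a (-y) ≤ mittagLeffler a a (-x) := by
  have hy : 0 ≤ y := hx.trans hxy
  have hφ : Continuous (fun s : ℝ => mittagLeffler a a (-x * (1 - s) ^ a)) :=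
    (ml_cont_pow ha ha).comp (continuous_const.sub continuous_id)
  have H := ml_swap ha ha ha y hφ.continuousOn
  set I := ∫ s in (0:ℝ)..1, s ^ (a - 1) * (1 - s) ^ (a - 1) * mittagLeffler a a (-x * (1 - s) ^ a) *
    mittagLeffler a a (-y * s ^ a) with hI
  have hI0 : 0 ≤ I := by
    apply intervalIntegral.integral_nonneg zero_le_one
    intro s hs
    have h1 : 0 ≤ 1 - s := by linarith [hs.2]
    have h0 := hs.1
    have p1 := ml_pos ha ha1 (show 0 ≤ x * (1 - s) ^ a by positivity)
    have p2 := ml_pos ha ha1 (show 0 ≤ y * s ^ a by positivity)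
    rw [← neg_mul] at p1 p2
    positivity
  set e : ℕ → ℝ := fun n => mittagLeffler a (a + a * n) (-x) with he
  have hstep : ∀ n, e n = 1 / Real.Gamma (a + a * n) - x * e (n + 1) := by
    intro n
    simp only [he]
    rw [ml_step ha (show 0 < a + a * n by positivity)]
    push_cast
    rw [show a + a * (n + 1 : ℝ) = a + a * n + a by ring]; ring
  have H2 : HasSum (fun n : ℕ => (-y) ^ n * e (n + 1)) I := by
    refine ml_hasSum_congr (fun n => ?_) rfl H
    have hp := Real.Gamma_pos_of_pos (show 0 < a + a * n by positivity)
    have h1 := ml_int ha ha (show 0 < a + a * n by positivity) x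
    have h2 := intervalIntegral.integral_comp_sub_left (a := 0) (b := 1) (fun s : ℝ =>
      s ^ (a - 1) * (1 - s) ^ (a + a * n - 1) * mittagLeffler a a (-x * s ^ a)) 1
    simp only [sub_zero, sub_self] at h2
    rw [h1] at h2
    have h3 : ∫ s in (0:ℝ)..1, s ^ (a + a * n - 1) * (1 - s) ^ (a - 1) *
        mittagLeffler a a (-x * (1 - s) ^ a) =
        Real.Gamma (a + a * n) * mittagLeffler a (a + (a + a * n)) (-x) := by
      rw [← h2]
      congr 1; ext s
      rw [sub_sub_cancel]; ring
    rw [h3]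
    simp only [he]
    push_cast
    rw [show a + a * (n + 1 : ℝ) = a + (a + a * n) by ring]
    field_simp
  have H3 : HasSum (fun n : ℕ => (-y) ^ n * e n) (mittagLeffler a a (-y) - x * I) := by
    have := (ml_summable ha ha (-y)).hasSum.sub (H2.mul_left x)
    refine ml_hasSum_congr (fun n => ?_) rfl this
    rw [hstep n]; ring
  have H4 : HasSum (fun n : ℕ => (-y) ^ n * e n) (e 0 + (-y) * I) := by
    rw [← hasSum_nat_add_iff' 1]
    have := H2.mul_left (-y)
    simp only [Finset.range_one, Finset.sum_singleton, pow_zero, one_mul, add_sub_cancel_left]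
    refine ml_hasSum_congr (fun n => ?_) rfl this
    rw [pow_succ]; ring
  have h5 := H3.unique H4
  have h6 : e 0 = mittagLeffler a a (-x) := by simp [he]
  rw [h6] at h5
  nlinarith

theorem ml_anti' {a b : ℝ} (ha : 0 < a) (ha1 : a ≤ 1) (hb : a < b) {x y : ℝ} (hx : 0 ≤ x)
    (hxy : x ≤ y) : mittagLeffler a b (-y) ≤ mittagLeffler a b (-x) := by
  have hq : 0 < b - a := by linarith
  have h1 := ml_int ha ha hq x
  have h2 := ml_int ha ha hq y
  rw [add_sub_cancel] at h1 h2
  have hG := Real.Gamma_pos_of_pos hq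
  refine le_of_mul_le_mul_left ?_ hG
  rw [← h1, ← h2]
  apply intervalIntegral.integral_mono_on zero_le_one (ml_intble ha ha ha hq)
    (ml_intble ha ha ha hq)
  intro s hs
  have h3 : 0 ≤ 1 - s := by linarith [hs.2]
  have h0 := hs.1
  apply mul_le_mul_of_nonneg_left _ (by positivity)
  rw [neg_mul, neg_mul]
  exact ml_anti ha ha1 (by positivity) (by gcongr)

theorem mittagLeffler_hyperbolic_bounds (α β x : ℝ)
    (hα : α ∈ Set.Ioc (0 : ℝ) 1) (hβ : α < β) (hx : 0 ≤ x) :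
    1 / (1 + Real.Gamma (β - α) / Real.Gamma β * x) ≤
      Real.Gamma β * mittagLeffler α β (-x) ∧
    Real.Gamma β * mittagLeffler α β (-x) ≤
      1 / (1 + Real.Gamma β / Real.Gamma (β + α) * x) := by
  obtain ⟨ha, ha1⟩ := hα
  have hb : 0 < β := ha.trans hβ
  have hq : 0 < β - α := by linarith
  have G1 := Real.Gamma_pos_of_pos hb
  have G2 := Real.Gamma_pos_of_pos hq
  have G3 := Real.Gamma_pos_of_pos (show 0 < β + α by linarith)
  have G4 := Real.Gamma_pos_of_pos ha
  have hs := ml_step ha hb (-x)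
  have hs' : Real.Gamma β * mittagLeffler α β (-x) =
      1 - x * (Real.Gamma β * mittagLeffler α (β + α) (-x)) := by
    rw [hs]; field_simp; ring
  constructor
  · rw [div_le_iff₀ (by positivity)]
    have key : Real.Gamma β * mittagLeffler α (β + α) (-x) ≤
        Real.Gamma (β - α) * mittagLeffler α β (-x) := by
      have h1 := ml_int ha ha hq x
      have h2 := ml_int ha ha hb x
      rw [add_sub_cancel] at h1
      rw [add_comm α β] at h2
      rw [← h1, ← h2]
      apply intervalIntegral.integral_mono_on_of_le_Ioo zero_le_one (ml_intble ha ha ha hb)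
        (ml_intble ha ha ha hq)
      intro s hs
      have h3 : 0 < 1 - s := by linarith [hs.2]
      have h0 := hs.1
      have p := ml_pos ha ha1 (show 0 ≤ x * s ^ α by positivity)
      rw [← neg_mul] at p
      apply mul_le_mul_of_nonneg_right _ p.le
      apply mul_le_mul_of_nonneg_left _ (by positivity)
      exact Real.rpow_le_rpow_of_exponent_ge h3 (by linarith) (by linarith)
    have e : Real.Gamma β * mittagLeffler α β (-x) * (1 + Real.Gamma (β - α) / Real.Gamma β * x) =
      Real.Gamma β * mittagLeffler α β (-x) + x * (Real.Gamma (β - α) * mittagLeffler α β (-x)) := by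
      field_simp
    rw [e]
    have := mul_le_mul_of_nonneg_left key hx
    linarith
  · rw [le_div_iff₀ (by positivity)]
    have key : Real.Gamma β * Real.Gamma α / Real.Gamma (β + α) * mittagLeffler α β (-x) ≤
        Real.Gamma α * mittagLeffler α (β + α) (-x) := by
      rw [← ml_int ha hb ha x, ← (ml_beta hb ha).2, ← intervalIntegral.integral_mul_const]
      apply intervalIntegral.integral_mono_on zero_le_one ((ml_beta hb ha).1.mul_const _)
        (ml_intble ha hb hb ha)
      intro s hs
      have h3 : 0 ≤ 1 - s := by linarith [hs.2]
      have h0 := hs.1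
      apply mul_le_mul_of_nonneg_left _ (by positivity)
      rw [neg_mul]
      apply ml_anti' ha ha1 hβ (by positivity)
      exact mul_le_of_le_one_right hx (Real.rpow_le_one h0 hs.2 ha.le)
    have key2 : Real.Gamma β / Real.Gamma (β + α) * mittagLeffler α β (-x) ≤
        mittagLeffler α (β + α) (-x) := by
      refine le_of_mul_le_mul_left ?_ G4
      refine le_trans (le_of_eq ?_) key
      ring
    have := mul_le_mul_of_nonneg_left key2 (mul_nonneg hx G1.le)
    nlinarith
end
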